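/- arXiv:1909.08518 — 8 statements merged into one kernel-verified Lean document; each statement's English description precedes it below -/
import Mathlib

section
/- Fix x ∈ 𝒳 and let τ₁ ≤ τ₂ be two bias parameters such that ℙ(X = x, R = 1, S_{τ₁} = 1) > 0. Then ℙ(X = x, R = 1, S_{τ₂} = 1) > 0 and E[Y | X = x, R = 1, S_{τ₂} = 1] ≤ E[Y | X = x, R = 1, S_{τ₁} = 1]. That is, the optimal predictor of Y on the searched sample for the group R = 1 is weakly decreasing in the bias parameter τ (Theorem 1, first part). -/
open MeasureTheory

/-- Conditional expectation given an event: `E[Z | A] = (∫_A Z dP) / P(A)`. -/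
noncomputable def condE {Ω : Type*} [MeasurableSpace Ω] (P : Measure Ω)
    (Z : Ω → ℝ) (A : Set Ω) : ℝ :=
  (∫ ω in A, Z ω ∂P) / (P A).toReal

/-- A set integral is nonnegative if it is so over every fibre of a countably valued map. -/
theorem setIntegral_nonneg_of_fibers {Ω 𝒰 : Type*} [MeasurableSpace Ω] {P : Measure Ω}
    [Countable 𝒰] [MeasurableSpace 𝒰] [MeasurableSingletonClass 𝒰] {U : Ω → 𝒰}
    (hU : Measurable U) {f : Ω → ℝ} (hf : Integrable f P) {G : Set Ω} (hG : MeasurableSet G)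
    (h : ∀ u, 0 ≤ ∫ ω in G ∩ U ⁻¹' {u}, f ω ∂P) : 0 ≤ ∫ ω in G, f ω ∂P := by
  have hG_eq : G = ⋃ u, G ∩ U ⁻¹' {u} := by
    ext ω
    simp
  rw [hG_eq, integral_iUnion (fun u => hG.inter (hU (measurableSet_singleton u))) _
    hf.integrableOn]
  · exact tsum_nonneg h
  · intro u v huv
    refine Set.disjoint_left.mpr ?_
    rintro ω ⟨-, hu⟩ ⟨-, hv⟩
    exact huv (hu.symm.trans hv)

/-- Enlarging `A` by a disjoint `D` on which the mean of `Z` is at most `k` does not increase the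
conditional expectation of `Z` when its mean on `A` is at least `k`. -/
theorem condE_union_le {Ω : Type*} [MeasurableSpace Ω] {P : Measure Ω} [IsFiniteMeasure P]
    {Z : Ω → ℝ} (hZ : Integrable Z P) {A D : Set Ω} (hD : MeasurableSet D)
    (hAD : Disjoint A D) (hA : 0 < P A) {k : ℝ} (hkA : 0 ≤ ∫ ω in A, (Z ω - k) ∂P)
    (hkD : 0 ≤ ∫ ω in D, (k - Z ω) ∂P) : condE P Z (A ∪ D) ≤ condE P Z A := by
  rw [integral_sub hZ.integrableOn (integrable_const k), setIntegral_const, smul_eq_mul] at hkA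
  rw [integral_sub (integrable_const k) hZ.integrableOn, setIntegral_const, smul_eq_mul] at hkD
  have hpA : 0 < P.real A := ENNReal.toReal_pos hA.ne' (measure_ne_top P A)
  have hpD : 0 ≤ P.real D := measureReal_nonneg
  have hunion : (P (A ∪ D)).toReal = P.real A + P.real D := measureReal_union hAD hD
  rw [condE, condE, setIntegral_union hAD hD hZ.integrableOn hZ.integrableOn, hunion,
    ← measureReal_def, div_le_div_iff₀ (by positivity) hpA]
  nlinarith [mul_nonneg hkA hpD, mul_nonneg hkD hpA.le]

/-- **Theorem 1, first part (bias reversal).** The optimal predictor of `Y` on the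
searched sample for the group `R = 1` is weakly decreasing in the bias parameter `τ`. -/
theorem bias_reversal_group_one
    {Ω : Type*} [MeasurableSpace Ω] (P : Measure Ω) [IsProbabilityMeasure P]
    {𝒳 𝒰 : Type*} [Countable 𝒳] [Countable 𝒰]
    [MeasurableSpace 𝒳] [MeasurableSingletonClass 𝒳]
    [MeasurableSpace 𝒰] [MeasurableSingletonClass 𝒰]
    (X : Ω → 𝒳) (U : Ω → 𝒰) (R Y : Ω → ℝ)
    (hX : Measurable X) (hU : Measurable U) (hR : Measurable R) (hY : Measurable Y)
    (hR01 : ∀ ω, R ω = 0 ∨ R ω = 1) (hY01 : ∀ ω, Y ω = 0 ∨ Y ω = 1)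
    -- every point of the essential range of (X, R, U) has positive mass
    (hXRU : ∀ ω, 0 < P {ω' | X ω' = X ω ∧ R ω' = R ω ∧ U ω' = U ω})
    (c : ℝ) (hc : 0 < c)
    -- μ(x, r, u) = E[Y | X = x, R = r, U = u]
    (μ : 𝒳 → ℝ → 𝒰 → ℝ)
    (hμ : ∀ x r u, μ x r u = condE P Y {ω | X ω = x ∧ R ω = r ∧ U ω = u})
    -- the search indicator S_τ = 1(μ(X, R, U) ≥ c − τ·R)
    (S : ℝ → Ω → ℝ)
    (hS : ∀ τ ω, S τ ω = if c - τ * R ω ≤ μ (X ω) (R ω) (U ω) then 1 else 0)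
    (x : 𝒳) (τ₁ τ₂ : ℝ) (hτ : τ₁ ≤ τ₂)
    (hpos : 0 < P {ω | X ω = x ∧ R ω = 1 ∧ S τ₁ ω = 1}) :
    0 < P {ω | X ω = x ∧ R ω = 1 ∧ S τ₂ ω = 1} ∧
      condE P Y {ω | X ω = x ∧ R ω = 1 ∧ S τ₂ ω = 1} ≤
        condE P Y {ω | X ω = x ∧ R ω = 1 ∧ S τ₁ ω = 1} := by
  have hsearch : ∀ τ, {ω | X ω = x ∧ R ω = 1 ∧ S τ ω = 1} =
      {ω | X ω = x ∧ R ω = 1} ∩ U ⁻¹' {u | c - τ ≤ μ x 1 u} := by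
    intro τ
    ext ω
    simp only [Set.mem_ofPred_eq, Set.mem_inter_iff, Set.mem_preimage, hS, and_assoc]
    refine and_congr_right fun hx => and_congr_right fun hr => ?_
    simp [hx, hr]
  have hcell : MeasurableSet {ω | X ω = x ∧ R ω = 1} :=
    (hX (measurableSet_singleton x)).inter (hR (measurableSet_singleton 1))
  have hmeas : ∀ T : Set 𝒰, MeasurableSet ({ω | X ω = x ∧ R ω = 1} ∩ U ⁻¹' T) :=
    fun T => hcell.inter (hU T.to_countable.measurableSet)
  have hY_int : Integrable Y P := by
    refine Integrable.of_bound hY.aestronglyMeasurable 1 (ae_of_all _ fun ω => ?_)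
    rcases hY01 ω with h | h <;> simp [h]
  have hfiber : ∀ (T : Set 𝒰) (f : Ω → ℝ), Integrable f P →
      (∀ u ∈ T, 0 ≤ ∫ ω in {ω | X ω = x ∧ R ω = 1 ∧ U ω = u}, f ω ∂P) →
      0 ≤ ∫ ω in {ω | X ω = x ∧ R ω = 1} ∩ U ⁻¹' T, f ω ∂P := by
    intro T f hf h
    refine setIntegral_nonneg_of_fibers hU hf (hmeas T) fun u => ?_
    by_cases hu : u ∈ T
    · convert h u hu using 3
      ext ω
      simp only [Set.mem_inter_iff, Set.mem_ofPred_eq, Set.mem_preimage, Set.mem_singleton_iff]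
      grind
    · have hempty : {ω | X ω = x ∧ R ω = 1} ∩ U ⁻¹' T ∩ U ⁻¹' {u} = ∅ := by
        ext ω
        simp only [Set.mem_inter_iff, Set.mem_ofPred_eq, Set.mem_preimage, Set.mem_singleton_iff,
          Set.mem_empty_iff_false]
        grind
      simp [hempty]
  have hmean : ∀ u, ∫ ω in {ω | X ω = x ∧ R ω = 1 ∧ U ω = u}, Y ω ∂P =
      μ x 1 u * P.real {ω | X ω = x ∧ R ω = 1 ∧ U ω = u} := by
    intro u
    rw [hμ, condE, ← measureReal_def]
    by_cases h0 : P.real {ω | X ω = x ∧ R ω = 1 ∧ U ω = u} = 0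
    · rw [h0, mul_zero]
      exact setIntegral_measure_zero _ ((measureReal_eq_zero_iff).mp h0)
    · rw [div_mul_cancel₀ _ h0]
  have hunion : {ω | X ω = x ∧ R ω = 1 ∧ S τ₂ ω = 1} = {ω | X ω = x ∧ R ω = 1 ∧ S τ₁ ω = 1} ∪
      {ω | X ω = x ∧ R ω = 1} ∩ U ⁻¹' {u | c - τ₂ ≤ μ x 1 u ∧ μ x 1 u < c - τ₁} := by
    rw [hsearch, hsearch, ← Set.inter_union_distrib_left, ← Set.preimage_union]
    congr 2
    ext u
    simp only [Set.mem_ofPred_eq, Set.mem_union]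
    grind
  refine ⟨hpos.trans_le (measure_mono (hunion ▸ Set.subset_union_left)), ?_⟩
  rw [hunion]
  refine condE_union_le (k := c - τ₁) hY_int (hmeas _) ?_ hpos ?_ ?_
  · rw [hsearch]
    refine Set.disjoint_left.mpr ?_
    rintro ω ⟨-, h₁⟩ ⟨-, h₂⟩
    exact h₂.2.not_ge h₁
  · rw [hsearch]
    refine hfiber _ _ (hY_int.sub (integrable_const _)) fun u hu => ?_
    rw [integral_sub hY_int.integrableOn (integrable_const _), setIntegral_const, smul_eq_mul,
      hmean, mul_comm (P.real _), ← sub_mul]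
    exact mul_nonneg (sub_nonneg.mpr hu) measureReal_nonneg
  · refine hfiber _ _ ((integrable_const _).sub hY_int) fun u hu => ?_
    rw [integral_sub (integrable_const _) hY_int.integrableOn, setIntegral_const, smul_eq_mul,
      hmean, mul_comm (P.real _), ← sub_mul]
    exact mul_nonneg (sub_nonneg.mpr hu.2.le) measureReal_nonneg
end

section
/- Fix a cutoff c_min ∈ [0,1] and define the automated search rule S^aut_τ(x, r) := 1(E[Y | X = x, R = r, S_τ = 1] ≥ c_min). Suppose ℙ(X = x, R = r, S_τ = 1) > 0 for every (x, r) in the essential range of (X, R) and every τ under consideration. Then for any τ′ < τ and any x: S^aut_τ(x, 1) ≤ S^aut_{τ′}(x, 1) (any individual in group R = 1 searched under the rule trained at bias τ is also searched under the rule trained at bias τ′), and S^aut_τ(x, 0) = S^aut_{τ′}(x, 0) (Corollary 1, pointwise part). -/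
open MeasureTheory

/-- If the mean of `Z` is at most `k` on each cell `B ∩ {U = u}` with `u ∈ V`, then it is at most
`k` on `B ∩ U ⁻¹' V`. -/
lemma setIntegral_inter_preimage_le {Ω 𝒰 : Type*} [MeasurableSpace Ω] [Countable 𝒰]
    [MeasurableSpace 𝒰] [MeasurableSingletonClass 𝒰] {P : Measure Ω} [IsFiniteMeasure P]
    {U : Ω → 𝒰} (hU : Measurable U) {Z : Ω → ℝ} (hZ : Integrable Z P)
    {B : Set Ω} (hB : MeasurableSet B) (V : Set 𝒰) (k : ℝ)
    (h : ∀ u ∈ V, ∫ ω in B ∩ U ⁻¹' {u}, Z ω ∂P ≤ k * P.real (B ∩ U ⁻¹' {u})) :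
    ∫ ω in B ∩ U ⁻¹' V, Z ω ∂P ≤ k * P.real (B ∩ U ⁻¹' V) := by
  have integral_sub_const : ∀ A : Set Ω,
      ∫ ω in A, (Z ω - k) ∂P = ∫ ω in A, Z ω ∂P - k * P.real A := fun A ↦ by
    rw [integral_sub hZ.integrableOn (integrable_const k), setIntegral_const, smul_eq_mul,
      mul_comm]
  have hunion : B ∩ U ⁻¹' V = ⋃ u : V, B ∩ U ⁻¹' {(u : 𝒰)} := by
    ext ω
    simp
  have hsum := hasSum_integral_iUnion (μ := P) (f := fun ω ↦ Z ω - k)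
    (s := fun u : V ↦ B ∩ U ⁻¹' {(u : 𝒰)})
    (fun u ↦ hB.inter (hU (measurableSet_singleton _)))
    (fun u v huv ↦ Set.disjoint_left.2 fun ω hu hv ↦
      huv (Subtype.ext (hu.2.symm.trans hv.2)))
    (hZ.sub (integrable_const k)).integrableOn
  rw [← hunion] at hsum
  have hle := hasSum_le (fun u : V ↦ (integral_sub_const _).trans_le
    (sub_nonpos.2 (h u u.2))) hsum hasSum_zero
  rw [integral_sub_const] at hle
  linarith

lemma setIntegral_eq_condE_mul {Ω : Type*} [MeasurableSpace Ω] (P : Measure Ω)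
    [IsFiniteMeasure P] (Z : Ω → ℝ) (A : Set Ω) :
    ∫ ω in A, Z ω ∂P = condE P Z A * P.real A := by
  by_cases hA : P A = 0
  · rw [Measure.restrict_eq_zero.2 hA, measureReal_def, hA]
    simp
  · exact (div_mul_cancel₀ _ (ENNReal.toReal_ne_zero.2 ⟨hA, measure_ne_top P A⟩)).symm

/-- Removing from `A` a part on which the mean of `Z` is at most `k` raises the mean, provided the
mean on the remaining part is at least `k`. -/
lemma condE_le_condE_of_subset {Ω : Type*} [MeasurableSpace Ω] {P : Measure Ω}
    [IsFiniteMeasure P] {Z : Ω → ℝ} (hZ : Integrable Z P) {A A' : Set Ω}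
    (hA' : MeasurableSet A') (hsub : A' ⊆ A) (hpos : 0 < P A') (k : ℝ)
    (hlow : k * P.real A' ≤ ∫ ω in A', Z ω ∂P)
    (hupp : ∫ ω in A \ A', Z ω ∂P ≤ k * P.real (A \ A')) :
    condE P Z A ≤ condE P Z A' := by
  have hp : 0 < P.real A' := ENNReal.toReal_pos hpos.ne' (measure_ne_top P A')
  have hq : 0 ≤ P.real (A \ A') := measureReal_nonneg
  have hmass : P.real A = P.real A' + P.real (A \ A') := by
    rw [measureReal_sdiff hsub hA']
    ring
  have hint : ∫ ω in A, Z ω ∂P = ∫ ω in A', Z ω ∂P + ∫ ω in A \ A', Z ω ∂P := by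
    rw [setIntegral_sdiff hA' hZ.integrableOn hsub]
    ring
  change (∫ ω in A, Z ω ∂P) / P.real A ≤ (∫ ω in A', Z ω ∂P) / P.real A'
  rw [hint, hmass, div_le_div_iff₀ (by linarith) hp]
  nlinarith [mul_le_mul_of_nonneg_right hlow hq, mul_le_mul_of_nonneg_right hupp hp.le]

/-- **Corollary 1, pointwise part.** The automated search rule
`S^aut_τ(x, r) := 1(E[Y | X = x, R = r, S_τ = 1] ≥ c_min)` satisfies
`S^aut_τ(x, 1) ≤ S^aut_{τ'}(x, 1)` and `S^aut_τ(x, 0) = S^aut_{τ'}(x, 0)` for `τ' < τ`. -/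
theorem automated_rule_pointwise
    {Ω : Type*} [MeasurableSpace Ω] (P : Measure Ω) [IsProbabilityMeasure P]
    {𝒳 𝒰 : Type*} [Countable 𝒳] [Countable 𝒰]
    [MeasurableSpace 𝒳] [MeasurableSingletonClass 𝒳]
    [MeasurableSpace 𝒰] [MeasurableSingletonClass 𝒰]
    (X : Ω → 𝒳) (U : Ω → 𝒰) (R Y : Ω → ℝ)
    (hX : Measurable X) (hU : Measurable U) (hR : Measurable R) (hY : Measurable Y)
    (hR01 : ∀ ω, R ω = 0 ∨ R ω = 1) (hY01 : ∀ ω, Y ω = 0 ∨ Y ω = 1)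
    -- every point of the essential range of (X, R, U) has positive mass
    (hXRU : ∀ ω, 0 < P {ω' | X ω' = X ω ∧ R ω' = R ω ∧ U ω' = U ω})
    (c : ℝ) (hc : 0 < c)
    -- μ(x, r, u) = E[Y | X = x, R = r, U = u]
    (μ : 𝒳 → ℝ → 𝒰 → ℝ)
    (hμ : ∀ x r u, μ x r u = condE P Y {ω | X ω = x ∧ R ω = r ∧ U ω = u})
    -- the search indicator S_τ = 1(μ(X, R, U) ≥ c − τ·R)
    (S : ℝ → Ω → ℝ)
    (hS : ∀ τ ω, S τ ω = if c - τ * R ω ≤ μ (X ω) (R ω) (U ω) then 1 else 0)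
    (cmin : ℝ) (hcmin : cmin ∈ Set.Icc (0 : ℝ) 1)
    -- the automated search rule S^aut_τ(x, r) = 1(E[Y | X = x, R = r, S_τ = 1] ≥ c_min)
    (Saut : ℝ → 𝒳 → ℝ → ℝ)
    (hSaut : ∀ t x r, Saut t x r =
      if cmin ≤ condE P Y {ω | X ω = x ∧ R ω = r ∧ S t ω = 1} then 1 else 0)
    (τ τ' : ℝ) (hττ' : τ' < τ)
    -- positivity of the searched sample for every (x, r) in the essential range
    -- of (X, R), at every bias parameter under consideration
    (hpos : ∀ t ∈ ({τ, τ'} : Set ℝ), ∀ x r, 0 < P {ω | X ω = x ∧ R ω = r} →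
      0 < P {ω | X ω = x ∧ R ω = r ∧ S t ω = 1}) :
    ∀ x : 𝒳, Saut τ x 1 ≤ Saut τ' x 1 ∧ Saut τ x 0 = Saut τ' x 0 := by
  intro x
  have hYint : Integrable Y P := Integrable.of_bound hY.aestronglyMeasurable 1
    (.of_forall fun ω ↦ by rcases hY01 ω with h | h <;> simp [h])
  have hsearch : ∀ t r, {ω | X ω = x ∧ R ω = r ∧ S t ω = 1} =
      {ω | X ω = x ∧ R ω = r} ∩ U ⁻¹' {u | c - t * r ≤ μ x r u} := fun t r ↦ by
    ext ω
    simp only [Set.mem_ofPred_eq, Set.mem_inter_iff, Set.mem_preimage, hS, and_assoc]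
    refine and_congr_right fun hx ↦ and_congr_right fun hr ↦ ?_
    rw [hx, hr]
    simp
  constructor
  · set B : Set Ω := {ω | X ω = x ∧ R ω = 1}
    have hB : MeasurableSet B :=
      (hX (measurableSet_singleton x)).inter (hR (measurableSet_singleton 1))
    have hcell : ∀ u, ∫ ω in B ∩ U ⁻¹' {u}, Y ω ∂P = μ x 1 u * P.real (B ∩ U ⁻¹' {u}) := by
      intro u
      have hset : {ω | X ω = x ∧ R ω = 1 ∧ U ω = u} = B ∩ U ⁻¹' {u} := by
        ext ω
        simp [B, and_assoc]
      rw [hμ, hset, setIntegral_eq_condE_mul]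
    have hmono : condE P Y {ω | X ω = x ∧ R ω = 1 ∧ S τ ω = 1} ≤
        condE P Y {ω | X ω = x ∧ R ω = 1 ∧ S τ' ω = 1} := by
      rcases eq_or_ne (P B) 0 with hB0 | hB0
      · have hzero : ∀ t, P {ω | X ω = x ∧ R ω = 1 ∧ S t ω = 1} = 0 := fun t ↦
          measure_mono_null (t := B) (fun ω hω ↦ ⟨hω.1, hω.2.1⟩) hB0
        simp [condE, hzero]
      · have hpos' := hpos τ' (by simp) x 1 (pos_iff_ne_zero.2 hB0)
        rw [hsearch] at hpos'
        rw [hsearch, hsearch]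
        refine condE_le_condE_of_subset hYint
          (hB.inter (hU (Set.to_countable _).measurableSet)) ?_ hpos' (c - τ' * 1) ?_ ?_
        · refine Set.inter_subset_inter_right _ (Set.preimage_mono fun u hu ↦ ?_)
          simp only [Set.mem_ofPred_eq] at hu ⊢
          linarith
        · have hneg := setIntegral_inter_preimage_le hU hYint.neg hB
            {u | c - τ' * 1 ≤ μ x 1 u} (-(c - τ' * 1)) fun u hu ↦ by
              simp only [Pi.neg_apply, integral_neg, hcell, neg_mul]
              exact neg_le_neg (mul_le_mul_of_nonneg_right hu measureReal_nonneg)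
          simp only [Pi.neg_apply, integral_neg, neg_mul] at hneg
          exact neg_le_neg_iff.1 hneg
        · rw [← Set.inter_sdiff_distrib_left, ← Set.preimage_sdiff]
          refine setIntegral_inter_preimage_le hU hYint hB _ _ fun u hu ↦ ?_
          rw [hcell]
          exact mul_le_mul_of_nonneg_right (not_le.1 hu.2).le measureReal_nonneg
    rw [hSaut, hSaut]
    split_ifs with h h'
    · exact le_rfl
    · exact absurd (h.trans hmono) h'
    · exact zero_le_one
    · exact le_rfl
  · simp only [hSaut, hsearch, mul_zero]
end

section
/- Fix a cutoff c_min ∈ [0,1] and define the automated search rule S^aut_τ(x, r) := 1(E[Y | X = x, R = r, S_τ = 1] ≥ c_min). Suppose ℙ(R = 1) > 0 and ℙ(X = x, R = r, S_τ = 1) > 0 for every (x, r) in the essential range of (X, R) and every τ under consideration. Then the fraction of group R = 1 searched by the automated rule, E[S^aut_τ(X, R) | R = 1], is weakly decreasing in τ, while the fraction of group R = 0 searched, E[S^aut_τ(X, R) | R = 0] (when ℙ(R = 0) > 0), is constant in τ (Corollary 1, aggregate part). -/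
open MeasureTheory

/-- The integral over the part of `D` where a countably valued `U` lies in `V` is nonnegative if
the integral over each slice `{U = u}`, `u ∈ V`, is. -/
lemma setIntegral_inter_preimage_nonneg {Ω 𝒰 : Type*} [MeasurableSpace Ω] {P : Measure Ω}
    [Countable 𝒰] [MeasurableSpace 𝒰] [MeasurableSingletonClass 𝒰] {U : Ω → 𝒰}
    (hU : Measurable U) {D : Set Ω} (hD : MeasurableSet D) {f : Ω → ℝ} (hf : Integrable f P)
    {V : Set 𝒰} (h : ∀ u ∈ V, 0 ≤ ∫ ω in D ∩ U ⁻¹' {u}, f ω ∂P) :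
    0 ≤ ∫ ω in D ∩ U ⁻¹' V, f ω ∂P := by
  have hV : D ∩ U ⁻¹' V = ⋃ u : V, D ∩ U ⁻¹' {u.1} := by
    ext ω
    simp
  rw [hV, integral_iUnion (fun u => hD.inter (hU (measurableSet_singleton _))) _ hf.integrableOn]
  · exact tsum_nonneg fun u => h u u.2
  · intro u v huv
    refine Set.disjoint_left.2 fun ω h₁ h₂ => huv (Subtype.ext ?_)
    exact h₁.2.symm.trans h₂.2

lemma setIntegral_sub_const_eq {Ω : Type*} [MeasurableSpace Ω] {P : Measure Ω}
    [IsFiniteMeasure P] {Y : Ω → ℝ} (hY : Integrable Y P) (A : Set Ω) (k : ℝ) :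
    ∫ ω in A, (Y ω - k) ∂P = (∫ ω in A, Y ω ∂P) - (P A).toReal * k := by
  rw [integral_sub hY.integrableOn (integrable_const k)]
  simp [Measure.real]

lemma setIntegral_sub_const_eq_condE {Ω : Type*} [MeasurableSpace Ω] {P : Measure Ω}
    [IsFiniteMeasure P] {Y : Ω → ℝ} (hY : Integrable Y P) (A : Set Ω) (k : ℝ) :
    ∫ ω in A, (Y ω - k) ∂P = (P A).toReal * (condE P Y A - k) := by
  rw [setIntegral_sub_const_eq hY, mul_sub, condE]
  congr 1
  by_cases h : P A = 0
  · simp [h, Measure.restrict_eq_zero.2 h]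
  · rw [mul_div_cancel₀]
    exact ENNReal.toReal_ne_zero.2 ⟨h, measure_ne_top P A⟩

/-- Lowering the threshold on the conditional mean of `Y` given `U` lowers the mean of `Y` over the
selected part of `D`. -/
lemma condE_threshold_antitone {Ω 𝒰 : Type*} [MeasurableSpace Ω] {P : Measure Ω}
    [IsFiniteMeasure P] [Countable 𝒰] [MeasurableSpace 𝒰] [MeasurableSingletonClass 𝒰]
    {U : Ω → 𝒰} (hU : Measurable U) {D : Set Ω} (hD : MeasurableSet D) {Y : Ω → ℝ}
    (hY : Integrable Y P) {k l : ℝ} (hlk : l ≤ k)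
    (hpos : 0 < P (D ∩ U ⁻¹' {u | k ≤ condE P Y (D ∩ U ⁻¹' {u})})) :
    condE P Y (D ∩ U ⁻¹' {u | l ≤ condE P Y (D ∩ U ⁻¹' {u})}) ≤
      condE P Y (D ∩ U ⁻¹' {u | k ≤ condE P Y (D ∩ U ⁻¹' {u})}) := by
  set m : 𝒰 → ℝ := fun u => condE P Y (D ∩ U ⁻¹' {u})
  change 0 < P (D ∩ U ⁻¹' {u | k ≤ m u}) at hpos
  change condE P Y (D ∩ U ⁻¹' {u | l ≤ m u}) ≤ condE P Y (D ∩ U ⁻¹' {u | k ≤ m u})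
  set A := D ∩ U ⁻¹' {u | k ≤ m u} with hA
  set B := D ∩ U ⁻¹' {u | l ≤ m u ∧ m u < k} with hB
  have hunion : D ∩ U ⁻¹' {u | l ≤ m u} = A ∪ B := by
    ext ω
    simp only [hA, hB, Set.mem_inter_iff, Set.mem_preimage, Set.mem_ofPred_eq, Set.mem_union]
    constructor
    · rintro ⟨h₁, h₂⟩
      rcases le_or_gt k (m (U ω)) with h | h
      · exact Or.inl ⟨h₁, h⟩
      · exact Or.inr ⟨h₁, h₂, h⟩
    · rintro (⟨h₁, h₂⟩ | ⟨h₁, h₂, -⟩)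
      · exact ⟨h₁, hlk.trans h₂⟩
      · exact ⟨h₁, h₂⟩
  have hdisj : Disjoint A B :=
    Set.disjoint_left.2 fun ω h₁ h₂ => absurd h₁.2 (not_le.2 h₂.2.2)
  have hBm : MeasurableSet B := hD.inter (hU (Set.to_countable _).measurableSet)
  have hsub : Integrable (fun ω => Y ω - k) P := hY.sub (integrable_const k)
  have hIA : 0 ≤ ∫ ω in A, (Y ω - k) ∂P := by
    refine setIntegral_inter_preimage_nonneg hU hD hsub fun u hu => ?_
    rw [setIntegral_sub_const_eq_condE hY]
    exact mul_nonneg ENNReal.toReal_nonneg (sub_nonneg.2 hu)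
  have hIB : 0 ≤ ∫ ω in B, -(Y ω - k) ∂P := by
    refine setIntegral_inter_preimage_nonneg hU hD hsub.neg fun u hu => ?_
    rw [Pi.neg_def, integral_neg, setIntegral_sub_const_eq_condE hY, ← mul_neg]
    exact mul_nonneg ENNReal.toReal_nonneg (neg_nonneg.2 (sub_nonpos.2 hu.2.le))
  rw [setIntegral_sub_const_eq hY] at hIA
  rw [integral_neg, setIntegral_sub_const_eq hY] at hIB
  rw [hunion, condE, condE, setIntegral_union hdisj hBm hY.integrableOn hY.integrableOn,
    measure_union hdisj hBm, ENNReal.toReal_add (measure_ne_top P A) (measure_ne_top P B)]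
  have ha : 0 < (P A).toReal := ENNReal.toReal_pos hpos.ne' (measure_ne_top P A)
  have hb : 0 ≤ (P B).toReal := ENNReal.toReal_nonneg
  rw [div_le_div_iff₀ (by positivity) ha]
  nlinarith [mul_nonneg hb hIA, mul_nonneg ha.le hIB]

/-- **Corollary 1, aggregate part.** The fraction of group `R = 1` searched by the
automated rule, `E[S^aut_τ(X, R) | R = 1]`, is weakly decreasing in `τ`, while the
fraction of group `R = 0` searched is constant in `τ`. -/
theorem automated_rule_aggregate
    {Ω : Type*} [MeasurableSpace Ω] (P : Measure Ω) [IsProbabilityMeasure P]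
    {𝒳 𝒰 : Type*} [Countable 𝒳] [Countable 𝒰]
    [MeasurableSpace 𝒳] [MeasurableSingletonClass 𝒳]
    [MeasurableSpace 𝒰] [MeasurableSingletonClass 𝒰]
    (X : Ω → 𝒳) (U : Ω → 𝒰) (R Y : Ω → ℝ)
    (hX : Measurable X) (hU : Measurable U) (hR : Measurable R) (hY : Measurable Y)
    (hR01 : ∀ ω, R ω = 0 ∨ R ω = 1) (hY01 : ∀ ω, Y ω = 0 ∨ Y ω = 1)
    -- every point of the essential range of (X, R, U) has positive mass
    (hXRU : ∀ ω, 0 < P {ω' | X ω' = X ω ∧ R ω' = R ω ∧ U ω' = U ω})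
    (c : ℝ) (hc : 0 < c)
    -- μ(x, r, u) = E[Y | X = x, R = r, U = u]
    (μ : 𝒳 → ℝ → 𝒰 → ℝ)
    (hμ : ∀ x r u, μ x r u = condE P Y {ω | X ω = x ∧ R ω = r ∧ U ω = u})
    -- the search indicator S_τ = 1(μ(X, R, U) ≥ c − τ·R)
    (S : ℝ → Ω → ℝ)
    (hS : ∀ τ ω, S τ ω = if c - τ * R ω ≤ μ (X ω) (R ω) (U ω) then 1 else 0)
    (cmin : ℝ) (hcmin : cmin ∈ Set.Icc (0 : ℝ) 1)
    -- the automated search rule S^aut_τ(x, r) = 1(E[Y | X = x, R = r, S_τ = 1] ≥ c_min)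
    (Saut : ℝ → 𝒳 → ℝ → ℝ)
    (hSaut : ∀ t x r, Saut t x r =
      if cmin ≤ condE P Y {ω | X ω = x ∧ R ω = r ∧ S t ω = 1} then 1 else 0)
    (τ₁ τ₂ : ℝ) (hτ : τ₁ ≤ τ₂)
    (hR1 : 0 < P {ω | R ω = 1})
    -- positivity of the searched sample for every (x, r) in the essential range
    -- of (X, R), at every bias parameter under consideration
    (hpos : ∀ t ∈ ({τ₁, τ₂} : Set ℝ), ∀ x r, 0 < P {ω | X ω = x ∧ R ω = r} →
      0 < P {ω | X ω = x ∧ R ω = r ∧ S t ω = 1}) :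
    condE P (fun ω => Saut τ₂ (X ω) (R ω)) {ω | R ω = 1} ≤
        condE P (fun ω => Saut τ₁ (X ω) (R ω)) {ω | R ω = 1} ∧
      (0 < P {ω | R ω = 0} →
        condE P (fun ω => Saut τ₁ (X ω) (R ω)) {ω | R ω = 0} =
          condE P (fun ω => Saut τ₂ (X ω) (R ω)) {ω | R ω = 0}) := by
  have hYint : Integrable Y P := by
    refine Integrable.of_bound hY.aestronglyMeasurable 1 (ae_of_all _ fun ω => ?_)
    rcases hY01 ω with h | h <;> simp [h]
  have hRm : ∀ r : ℝ, MeasurableSet {ω | R ω = r} := fun r => hR (measurableSet_singleton r)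
  have hDm : ∀ x r, MeasurableSet {ω | X ω = x ∧ R ω = r} := fun x r =>
    (hX (measurableSet_singleton x)).inter (hRm r)
  have hslice : ∀ x r u, {ω | X ω = x ∧ R ω = r ∧ U ω = u} =
      {ω | X ω = x ∧ R ω = r} ∩ U ⁻¹' {u} := fun x r u => by
    ext ω
    simp [and_assoc]
  have hsearched : ∀ t x r, {ω | X ω = x ∧ R ω = r ∧ S t ω = 1} =
      {ω | X ω = x ∧ R ω = r} ∩
        U ⁻¹' {u | c - t * r ≤ condE P Y ({ω | X ω = x ∧ R ω = r} ∩ U ⁻¹' {u})} := by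
    intro t x r
    ext ω
    simp only [Set.mem_inter_iff, Set.mem_preimage, Set.mem_ofPred_eq, ← hslice, ← hμ, hS,
      and_assoc]
    refine and_congr_right fun hx => and_congr_right fun hr => ?_
    rw [hx, hr]
    simp
  constructor
  · have hint : ∀ t, IntegrableOn (fun ω => Saut t (X ω) (R ω)) {ω | R ω = 1} P := by
      intro t
      refine IntegrableOn.congr_fun (f := fun ω => Saut t (X ω) 1) ?_
        (fun ω hω => by simp only [Set.mem_ofPred_eq] at hω; simp only [hω]) (hRm 1)
      refine Integrable.integrableOn (Integrable.of_bound (C := 1)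
        ((measurable_of_countable fun x => Saut t x 1).comp hX).aestronglyMeasurable
        (ae_of_all _ fun ω => ?_))
      rw [hSaut]
      split_ifs <;> simp
    refine div_le_div_of_nonneg_right ?_ ENNReal.toReal_nonneg
    refine setIntegral_mono_on (hint τ₂) (hint τ₁) (hRm 1) fun ω hω => ?_
    have hle : condE P Y {ω' | X ω' = X ω ∧ R ω' = R ω ∧ S τ₂ ω' = 1} ≤
        condE P Y {ω' | X ω' = X ω ∧ R ω' = R ω ∧ S τ₁ ω' = 1} := by
      have hp := hpos τ₁ (by simp) (X ω) (R ω)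
        ((hXRU ω).trans_le (measure_mono fun _ h => ⟨h.1, h.2.1⟩))
      rw [hsearched] at hp
      rw [hsearched, hsearched]
      refine condE_threshold_antitone hU (hDm _ _) hYint ?_ hp
      rw [show R ω = 1 from hω]
      linarith
    rw [hSaut, hSaut]
    split_ifs with h₂ h₁
    · exact le_rfl
    · exact absurd (h₂.trans hle) h₁
    · exact zero_le_one
    · exact le_rfl
  · intro _
    unfold condE
    congr 1
    refine setIntegral_congr_fun (hRm 0) fun ω hω => ?_
    simp only [Set.mem_ofPred_eq] at hω
    simp only [hSaut, hsearched, hω, mul_zero]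
end

section
/- Fix a cutoff c_min ∈ [0,1], assume ℙ(R = 1) > 0 and ℙ(X = x, R = r) > 0 for every (x, r) in the essential range of (X, R), and define the automated rule Š_τ(x, r) := 1(E[S_τ | X = x, R = r] ≥ c_min), which thresholds the predictor of the human decision S_τ. Then for any τ < τ′ and any x, Š_τ(x, 1) ≤ Š_{τ′}(x, 1), and consequently the fraction of group R = 1 searched, E[Š_τ(X, R) | R = 1], is weakly increasing in τ (Corollary 2, version with label S*). -/
open MeasureTheory

/-- On an event where two variables are indicators of predicates of a discrete random variable,
one predicate implying the other, their conditional expectations are ordered. -/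
lemma condE_le_condE_of_indicator {Ω β : Type*} [MeasurableSpace Ω] (P : Measure Ω)
    [IsFiniteMeasure P] [MeasurableSpace β] [DiscreteMeasurableSpace β] {V : Ω → β}
    (hV : Measurable V) {A : Set Ω} (hA : MeasurableSet A) {s t : Set β} (hst : s ⊆ t)
    {Z W : Ω → ℝ} (hZ : Set.EqOn Z ((V ⁻¹' s).indicator 1) A)
    (hW : Set.EqOn W ((V ⁻¹' t).indicator 1) A) :
    condE P Z A ≤ condE P W A := by
  have hint (q : Set β) : Integrable ((V ⁻¹' q).indicator (1 : Ω → ℝ)) (P.restrict A) :=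
    (integrable_const (1 : ℝ)).indicator (hV (MeasurableSet.of_discrete (s := q)))
  unfold condE
  rw [setIntegral_congr_fun hA hZ, setIntegral_congr_fun hA hW]
  gcongr ?_ / _
  exact setIntegral_mono (hint s) (hint t) <|
    Set.indicator_le_indicator_of_subset (Set.preimage_mono hst) fun _ => zero_le_one' ℝ

/-- **Corollary 2 (version with label `S*`).** The automated rule
`Š_τ(x, r) := 1(E[S_τ | X = x, R = r] ≥ c_min)` satisfies `Š_τ(x, 1) ≤ Š_{τ'}(x, 1)`
for `τ < τ'`, and the fraction of group `R = 1` searched, `E[Š_τ(X, R) | R = 1]`,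
is weakly increasing in `τ`. -/
theorem automated_rule_Sstar_inherits_bias
    {Ω : Type*} [MeasurableSpace Ω] (P : Measure Ω) [IsProbabilityMeasure P]
    {𝒳 𝒰 : Type*} [Countable 𝒳] [Countable 𝒰]
    [MeasurableSpace 𝒳] [MeasurableSingletonClass 𝒳]
    [MeasurableSpace 𝒰] [MeasurableSingletonClass 𝒰]
    (X : Ω → 𝒳) (U : Ω → 𝒰) (R Y : Ω → ℝ)
    (hX : Measurable X) (hU : Measurable U) (hR : Measurable R) (hY : Measurable Y)
    (hR01 : ∀ ω, R ω = 0 ∨ R ω = 1) (hY01 : ∀ ω, Y ω = 0 ∨ Y ω = 1)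
    -- every point of the essential range of (X, R, U) has positive mass
    (hXRU : ∀ ω, 0 < P {ω' | X ω' = X ω ∧ R ω' = R ω ∧ U ω' = U ω})
    (c : ℝ) (hc : 0 < c)
    -- μ(x, r, u) = E[Y | X = x, R = r, U = u]
    (μ : 𝒳 → ℝ → 𝒰 → ℝ)
    (hμ : ∀ x r u, μ x r u = condE P Y {ω | X ω = x ∧ R ω = r ∧ U ω = u})
    -- the search indicator S_τ = 1(μ(X, R, U) ≥ c − τ·R)
    (S : ℝ → Ω → ℝ)
    (hS : ∀ τ ω, S τ ω = if c - τ * R ω ≤ μ (X ω) (R ω) (U ω) then 1 else 0)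
    (cmin : ℝ) (hcmin : cmin ∈ Set.Icc (0 : ℝ) 1)
    (hR1 : 0 < P {ω | R ω = 1})
    -- every point of the essential range of (X, R) has positive mass
    (hXR : ∀ ω, 0 < P {ω' | X ω' = X ω ∧ R ω' = R ω})
    -- the automated rule Š_τ(x, r) = 1(E[S_τ | X = x, R = r] ≥ c_min)
    (Scheck : ℝ → 𝒳 → ℝ → ℝ)
    (hScheck : ∀ t x r, Scheck t x r =
      if cmin ≤ condE P (S t) {ω | X ω = x ∧ R ω = r} then 1 else 0)
    (τ τ' : ℝ) (hττ' : τ < τ') :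
    (∀ x : 𝒳, Scheck τ x 1 ≤ Scheck τ' x 1) ∧
      condE P (fun ω => Scheck τ (X ω) (R ω)) {ω | R ω = 1} ≤
        condE P (fun ω => Scheck τ' (X ω) (R ω)) {ω | R ω = 1} := by
  have hA : MeasurableSet {ω | R ω = 1} := hR (measurableSet_singleton 1)
  have hcond (x : 𝒳) : condE P (S τ) {ω | X ω = x ∧ R ω = 1} ≤
      condE P (S τ') {ω | X ω = x ∧ R ω = 1} := by
    refine condE_le_condE_of_indicator P (hX.prodMk hU)
      ((hX (measurableSet_singleton x)).inter hA)
      (s := {p | c - τ ≤ μ p.1 1 p.2}) (t := {p | c - τ' ≤ μ p.1 1 p.2})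
      (fun p (hp : c - τ ≤ _) => (by linarith : c - τ' ≤ _)) ?_ ?_ <;>
    · rintro ω ⟨-, hω : R ω = 1⟩
      simp [hS, hω, Set.indicator_apply]
  refine ⟨fun x => ?_, ?_⟩
  · rw [hScheck, hScheck]
    have := hcond x
    split_ifs <;> linarith
  · refine condE_le_condE_of_indicator P hX hA
      (s := {x | cmin ≤ condE P (S τ) {ω | X ω = x ∧ R ω = 1}})
      (t := {x | cmin ≤ condE P (S τ') {ω | X ω = x ∧ R ω = 1}})
      (fun x hx => le_trans hx (hcond x)) ?_ ?_ <;>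
    · intro ω (hω : R ω = 1)
      simp [hScheck, hω, Set.indicator_apply]
end

section
/- Fix a cutoff c_min ∈ [0,1], assume ℙ(R = 1) > 0 and ℙ(X = x, R = r) > 0 for every (x, r) in the essential range of (X, R), and define the automated rule Š_τ(x, r) := 1(E[Y·S_τ | X = x, R = r] ≥ c_min), which thresholds the predictor of the compound label Y·S_τ. Then for any τ < τ′ and any x, Š_τ(x, 1) ≤ Š_{τ′}(x, 1), and consequently the fraction of group R = 1 searched, E[Š_τ(X, R) | R = 1], is weakly increasing in τ (Corollary 2, version with label Y·S*). -/
open MeasureTheory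

/-- Monotonicity of the conditional expectation given an event, for integrands that are
ordered on that event. -/
lemma condE_mono_on {Ω : Type*} [MeasurableSpace Ω] {P : Measure Ω} {f g : Ω → ℝ} {A : Set Ω}
    (hA : MeasurableSet A) (hf : IntegrableOn f A P) (hg : IntegrableOn g A P)
    (h : ∀ ω ∈ A, f ω ≤ g ω) : condE P f A ≤ condE P g A :=
  div_le_div_of_nonneg_right (setIntegral_mono_on hf hg hA h) ENNReal.toReal_nonneg

/-- A function that agrees on a measurable set with a measurable function bounded by `1` is
integrable there. -/
lemma integrableOn_of_eqOn_of_abs_le_one {Ω : Type*} [MeasurableSpace Ω] {P : Measure Ω}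
    [IsFiniteMeasure P] {f g : Ω → ℝ} {A : Set Ω} (hA : MeasurableSet A) (hg : Measurable g)
    (hfg : Set.EqOn f g A) (hbound : ∀ ω, |g ω| ≤ 1) : IntegrableOn f A P :=
  (Integrable.of_bound hg.aestronglyMeasurable 1 (ae_of_all _ hbound)).integrableOn.congr_fun
    hfg.symm hA

/-- **Corollary 2 (version with label `Y·S*`).** The automated rule
`Š_τ(x, r) := 1(E[Y·S_τ | X = x, R = r] ≥ c_min)` satisfies `Š_τ(x, 1) ≤ Š_{τ'}(x, 1)`
for `τ < τ'`, and the fraction of group `R = 1` searched, `E[Š_τ(X, R) | R = 1]`,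
is weakly increasing in `τ`. -/
theorem automated_rule_YSstar_inherits_bias
    {Ω : Type*} [MeasurableSpace Ω] (P : Measure Ω) [IsProbabilityMeasure P]
    {𝒳 𝒰 : Type*} [Countable 𝒳] [Countable 𝒰]
    [MeasurableSpace 𝒳] [MeasurableSingletonClass 𝒳]
    [MeasurableSpace 𝒰] [MeasurableSingletonClass 𝒰]
    (X : Ω → 𝒳) (U : Ω → 𝒰) (R Y : Ω → ℝ)
    (hX : Measurable X) (hU : Measurable U) (hR : Measurable R) (hY : Measurable Y)
    (hR01 : ∀ ω, R ω = 0 ∨ R ω = 1) (hY01 : ∀ ω, Y ω = 0 ∨ Y ω = 1)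
    -- every point of the essential range of (X, R, U) has positive mass
    (hXRU : ∀ ω, 0 < P {ω' | X ω' = X ω ∧ R ω' = R ω ∧ U ω' = U ω})
    (c : ℝ) (hc : 0 < c)
    -- μ(x, r, u) = E[Y | X = x, R = r, U = u]
    (μ : 𝒳 → ℝ → 𝒰 → ℝ)
    (hμ : ∀ x r u, μ x r u = condE P Y {ω | X ω = x ∧ R ω = r ∧ U ω = u})
    -- the search indicator S_τ = 1(μ(X, R, U) ≥ c − τ·R)
    (S : ℝ → Ω → ℝ)
    (hS : ∀ τ ω, S τ ω = if c - τ * R ω ≤ μ (X ω) (R ω) (U ω) then 1 else 0)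
    (cmin : ℝ) (hcmin : cmin ∈ Set.Icc (0 : ℝ) 1)
    (hR1 : 0 < P {ω | R ω = 1})
    -- every point of the essential range of (X, R) has positive mass
    (hXR : ∀ ω, 0 < P {ω' | X ω' = X ω ∧ R ω' = R ω})
    -- the automated rule Š_τ(x, r) = 1(E[Y·S_τ | X = x, R = r] ≥ c_min)
    (Scheck : ℝ → 𝒳 → ℝ → ℝ)
    (hScheck : ∀ t x r, Scheck t x r =
      if cmin ≤ condE P (fun ω => Y ω * S t ω) {ω | X ω = x ∧ R ω = r} then 1 else 0)
    (τ τ' : ℝ) (hττ' : τ < τ') :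
    (∀ x : 𝒳, Scheck τ x 1 ≤ Scheck τ' x 1) ∧
      condE P (fun ω => Scheck τ (X ω) (R ω)) {ω | R ω = 1} ≤
        condE P (fun ω => Scheck τ' (X ω) (R ω)) {ω | R ω = 1} := by
  have hA1 : MeasurableSet {ω | R ω = 1} := hR (measurableSet_singleton 1)
  have hAx (x : 𝒳) : MeasurableSet {ω | X ω = x ∧ R ω = 1} :=
    (hX (measurableSet_singleton x)).inter hA1
  have hYS_int (t : ℝ) (x : 𝒳) :
      IntegrableOn (fun ω => Y ω * S t ω) {ω | X ω = x ∧ R ω = 1} P := by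
    have hmeas : Measurable fun ω => if c - t ≤ μ x 1 (U ω) then (1 : ℝ) else 0 :=
      (measurable_of_countable fun u => if c - t ≤ μ x 1 u then (1 : ℝ) else 0).comp hU
    refine integrableOn_of_eqOn_of_abs_le_one (hAx x) (hY.mul hmeas) ?_ fun ω => ?_
    · rintro ω ⟨hx, hr⟩
      simp [hS, hx, hr]
    · rcases hY01 ω with h | h <;> simp only [Pi.mul_apply, h] <;> split_ifs <;> simp
  have hrule (x : 𝒳) : Scheck τ x 1 ≤ Scheck τ' x 1 := by
    have hmono : condE P (fun ω => Y ω * S τ ω) {ω | X ω = x ∧ R ω = 1} ≤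
        condE P (fun ω => Y ω * S τ' ω) {ω | X ω = x ∧ R ω = 1} := by
      refine condE_mono_on (hAx x) (hYS_int τ x) (hYS_int τ' x) ?_
      rintro ω ⟨-, hr⟩
      have hY0 : 0 ≤ Y ω := by rcases hY01 ω with h | h <;> simp [h]
      refine mul_le_mul_of_nonneg_left ?_ hY0
      rw [hS, hS, hr]
      split_ifs <;> linarith
    rw [hScheck, hScheck]
    split_ifs <;> linarith
  have hScheck_int (t : ℝ) :
      IntegrableOn (fun ω => Scheck t (X ω) (R ω)) {ω | R ω = 1} P := by
    refine integrableOn_of_eqOn_of_abs_le_one hA1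
      ((measurable_of_countable fun x => Scheck t x 1).comp hX) ?_ fun ω => ?_
    · intro ω hr
      simp only [Set.mem_ofPred_eq] at hr
      simp [hr]
    · simp only [Function.comp_apply, hScheck]
      split_ifs <;> simp
  refine ⟨hrule, condE_mono_on hA1 (hScheck_int τ) (hScheck_int τ') fun ω hr => ?_⟩
  simp only [Set.mem_ofPred_eq] at hr
  simpa only [hr] using hrule (X ω)
end

section
/- Suppose the police search according to S^noise_τ := 1(μ(X, R, U) + ε ≥ c − τ·R), where ε is a real-valued random variable such that, for each (x, r) in the essential range of (X, R), under the conditional measure ℙ(· | X = x, R = r) the variable ε is independent of the pair (Y, U) and has a density f_{x,r} with respect to Lebesgue measure whose hazard rate t ↦ f_{x,r}(t)/(1 − F_{x,r}(t)) is strictly increasing on {t : F_{x,r}(t) < 1}, where F_{x,r} is the corresponding CDF. Then for every x ∈ 𝒳 and every τ₁ ≤ τ₂ with ℙ(X = x, R = 1, S^noise_{τ₁} = 1) > 0, one has ℙ(X = x, R = 1, S^noise_{τ₂} = 1) > 0 and E[Y | X = x, R = 1, S^noise_{τ₂} = 1] ≤ E[Y | X = x, R = 1, S^noise_{τ₁}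 = 1] (Proposition 1: bias reversal is robust to noisy decision-making). -/
open MeasureTheory ProbabilityTheory

theorem condE_inter {Ω : Type*} [MeasurableSpace Ω] {P : Measure Ω} [IsFiniteMeasure P]
    (Z : Ω → ℝ) {A B : Set Ω} (hA : MeasurableSet A) (hB : MeasurableSet B) (hPA : P A ≠ 0) :
    condE P Z (A ∩ B) = condE (P[|A]) Z B := by
  have hA0 : (P A)⁻¹.toReal ≠ 0 :=
    ENNReal.toReal_ne_zero.2 ⟨ENNReal.inv_ne_zero.2 (measure_ne_top _ _), ENNReal.inv_ne_top.2 hPA⟩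
  rw [condE, condE, cond_apply hA, ProbabilityTheory.cond, Measure.restrict_smul,
    Measure.restrict_restrict hB, integral_smul_measure, ENNReal.toReal_mul, smul_eq_mul,
    mul_div_mul_left _ _ hA0, Set.inter_comm B A]

theorem abs_condE_le_one {Ω : Type*} [MeasurableSpace Ω] {P : Measure Ω} [IsFiniteMeasure P]
    {Z : Ω → ℝ} (hZ : ∀ ω, |Z ω| ≤ 1) (A : Set Ω) : |condE P Z A| ≤ 1 := by
  rw [condE, abs_div, abs_of_nonneg (ENNReal.toReal_nonneg (a := P A))]
  refine div_le_one_of_le₀ ?_ ENNReal.toReal_nonneg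
  simpa [Measure.real] using norm_setIntegral_le_of_norm_le_const (μ := P) (s := A) (f := Z)
    (measure_lt_top _ _) (C := 1) fun ω _ => hZ ω

theorem measureReal_Ici_eq_add {ν : Measure ℝ} [IsFiniteMeasure ν] (t : ℝ) {δ : ℝ} (hδ : 0 ≤ δ) :
    ν.real (Set.Ici t) = ν.real (Set.Ico t (t + δ)) + ν.real (Set.Ici (t + δ)) := by
  rw [← Set.Ico_union_Ici_eq_Ici (show t ≤ t + δ by linarith),
    measureReal_union _ measurableSet_Ici]
  exact Set.disjoint_left.2 fun s hs hs' => not_lt.2 hs' hs.2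

/-- A hazard rate at most `k` on `[t, t + δ)` bounds the decay of the survival function from above. -/
theorem survival_decay_le {ν : Measure ℝ} [IsProbabilityMeasure ν] {f : ℝ → ℝ}
    (hν : ν = volume.withDensity fun t => ENNReal.ofReal (f t)) {k t δ : ℝ} (hk : 0 ≤ k)
    (hδ : 0 ≤ δ) (hf : ∀ s, t ≤ s → s < t + δ → f s ≤ k * ν.real (Set.Ici s)) :
    (1 - k * δ) * ν.real (Set.Ici t) ≤ ν.real (Set.Ici (t + δ)) := by
  have hsplit := measureReal_Ici_eq_add (ν := ν) t hδ
  have hle : ν (Set.Ico t (t + δ)) ≤ ENNReal.ofReal (k * ν.real (Set.Ici t) * δ) := by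
    calc ν (Set.Ico t (t + δ)) = ∫⁻ s in Set.Ico t (t + δ), ENNReal.ofReal (f s) := by
          conv_lhs => rw [hν]
          exact withDensity_apply _ measurableSet_Ico
      _ ≤ ∫⁻ _ in Set.Ico t (t + δ), ENNReal.ofReal (k * ν.real (Set.Ici t)) := by
          refine setLIntegral_mono' measurableSet_Ico fun s hs => ENNReal.ofReal_le_ofReal ?_
          refine (hf s hs.1 hs.2).trans ?_
          gcongr
          exacts [measure_ne_top _ _, hs.1]
      _ = _ := by
          rw [setLIntegral_const, Real.volume_Ico, add_sub_cancel_left,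
            ← ENNReal.ofReal_mul (by positivity)]
  have hreal : ν.real (Set.Ico t (t + δ)) ≤ k * ν.real (Set.Ici t) * δ :=
    ENNReal.toReal_le_of_le_ofReal (by positivity) hle
  linarith

/-- A hazard rate at least `k` on `[t, t + δ)` bounds the decay of the survival function from below. -/
theorem le_survival_decay {ν : Measure ℝ} [IsProbabilityMeasure ν] {f : ℝ → ℝ}
    (hν : ν = volume.withDensity fun t => ENNReal.ofReal (f t)) {k t δ : ℝ} (hk : 0 ≤ k)
    (hδ : 0 ≤ δ)
    (hf : ∀ s, t ≤ s → s < t + δ → k * ν.real (Set.Ici s) ≤ max (f s) 0) :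
    (1 + k * δ) * ν.real (Set.Ici (t + δ)) ≤ ν.real (Set.Ici t) := by
  have hsplit := measureReal_Ici_eq_add (ν := ν) t hδ
  have hle : ENNReal.ofReal (k * ν.real (Set.Ici (t + δ)) * δ) ≤ ν (Set.Ico t (t + δ)) := by
    calc _ = ∫⁻ _ in Set.Ico t (t + δ), ENNReal.ofReal (k * ν.real (Set.Ici (t + δ))) := by
          rw [setLIntegral_const, Real.volume_Ico, add_sub_cancel_left,
            ← ENNReal.ofReal_mul (by positivity)]
      _ ≤ ∫⁻ s in Set.Ico t (t + δ), ENNReal.ofReal (f s) := by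
          refine setLIntegral_mono' measurableSet_Ico fun s hs => ?_
          have h1 : k * ν.real (Set.Ici (t + δ)) ≤ max (f s) 0 := by
            refine le_trans ?_ (hf s hs.1 hs.2)
            gcongr
            exacts [measure_ne_top _ _, hs.2.le]
          simpa using ENNReal.ofReal_le_ofReal h1
      _ = _ := by
          conv_rhs => rw [hν]
          exact (withDensity_apply _ measurableSet_Ico).symm
  have hreal : k * ν.real (Set.Ici (t + δ)) * δ ≤ ν.real (Set.Ico t (t + δ)) :=
    (ENNReal.ofReal_le_iff_le_toReal (measure_ne_top _ _)).1 hle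
  linarith

/-- Log-concavity of the survival function, when the shifted left point stays left of `b`. -/
theorem survival_mul_le_of_add_le {ν : Measure ℝ} [IsProbabilityMeasure ν] {f : ℝ → ℝ}
    (hν : ν = volume.withDensity fun t => ENNReal.ofReal (f t))
    (hmono : MonotoneOn (fun t => f t / ν.real (Set.Ici t)) {t | 0 < ν.real (Set.Ici t)})
    {a b d : ℝ} (hd : 0 ≤ d) (hab : a + d ≤ b) :
    ν.real (Set.Ici a) * ν.real (Set.Ici (b + d)) ≤
      ν.real (Set.Ici (a + d)) * ν.real (Set.Ici b) := by
  have hanti : ∀ {s t : ℝ}, s ≤ t → ν.real (Set.Ici t) ≤ ν.real (Set.Ici s) := fun h =>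
    measureReal_mono (Set.Ici_subset_Ici.2 h)
  rcases (measureReal_nonneg (μ := ν) (s := Set.Ici (b + d))).eq_or_lt with h0 | h0
  · rw [← h0, mul_zero]; positivity
  have hpos : ∀ {t}, t ≤ b + d → 0 < ν.real (Set.Ici t) := fun h => h0.trans_le (hanti h)
  set k := max (f (a + d) / ν.real (Set.Ici (a + d))) 0 with hkdef
  have hk : 0 ≤ k := le_max_right _ _
  have hflow : ∀ s, s ≤ a + d → f s ≤ k * ν.real (Set.Ici s) := fun s hs => by
    have := hmono (hpos (by linarith)) (hpos (t := a + d) (by linarith)) hs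
    exact (div_le_iff₀ (hpos (by linarith))).1 (this.trans (le_max_left _ _))
  have hfup : ∀ s, b ≤ s → s ≤ b + d → k * ν.real (Set.Ici s) ≤ max (f s) 0 := fun s hs hs' => by
    have := hmono (hpos (t := a + d) (by linarith)) (hpos hs') (hab.trans hs)
    rw [hkdef, max_mul_of_nonneg _ _ measureReal_nonneg, zero_mul]
    exact max_le_max_right _ ((le_div_iff₀ (hpos hs')).1 this)
  have hn : ∀ n : ℕ, max (k * d) 1 ≤ n → (1 - (k * d) ^ 2 / n) *
      (ν.real (Set.Ici a) * ν.real (Set.Ici (b + d))) ≤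
        ν.real (Set.Ici (a + d)) * ν.real (Set.Ici b) := fun n hn => by
    have hn1 : (1 : ℝ) ≤ n := (le_max_right _ _).trans hn
    have hn0 : (0 : ℝ) < n := by linarith
    have hkn : k * d ≤ n := (le_max_left _ _).trans hn
    set δ := d / n with hδdef
    have hδ : 0 ≤ δ := by positivity
    have hnδ : n * δ = d := by rw [hδdef]; field_simp
    have hy : k * δ ≤ 1 := by
      rw [hδdef, ← mul_div_assoc, div_le_one hn0]; exact hkn
    have hy0 : 0 ≤ k * δ := by positivity
    have hmul : ∀ {j : ℕ}, j ≤ n → j * δ ≤ d := fun {j} hj => by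
      rw [← hnδ]; gcongr
    have hlow : ∀ j : ℕ, j ≤ n → (1 - k * δ) ^ j * ν.real (Set.Ici a) ≤
        ν.real (Set.Ici (a + j * δ)) := fun j => by
      induction j with
      | zero => intro _; simp
      | succ j ih =>
        intro hj
        have h1 := hmul hj
        push_cast at h1 ⊢
        have h2 := survival_decay_le hν hk hδ (t := a + j * δ)
          (fun s _ hs => hflow s (by linarith))
        rw [show a + (j + 1) * δ = a + j * δ + δ by ring, pow_succ']
        refine le_trans ?_ h2
        rw [mul_assoc]
        exact mul_le_mul_of_nonneg_left (ih (by omega)) (by linarith)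
    have hup : ∀ j : ℕ, j ≤ n → (1 + k * δ) ^ j * ν.real (Set.Ici (b + j * δ)) ≤
        ν.real (Set.Ici b) := fun j => by
      induction j with
      | zero => intro _; simp
      | succ j ih =>
        intro hj
        have h1 := hmul hj
        push_cast at h1 ⊢
        have hj0 : 0 ≤ j * δ := by positivity
        have h2 := le_survival_decay hν hk hδ (t := b + j * δ)
          (fun s hs' hs => hfup s (by linarith) (by linarith))
        rw [show b + (j + 1) * δ = b + j * δ + δ by ring, pow_succ, mul_assoc]
        exact (mul_le_mul_of_nonneg_left h2 (by positivity)).trans (ih (by omega))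
    have hl := hlow n le_rfl
    have hu := hup n le_rfl
    rw [hnδ] at hl hu
    have hbern : 1 - (k * d) ^ 2 / n ≤ (1 - k * δ) ^ n * (1 + k * δ) ^ n := by
      rw [← mul_pow]
      have := one_add_mul_le_pow (a := -(k * δ) ^ 2) (by nlinarith) n
      calc _ = 1 + (n : ℝ) * -(k * δ) ^ 2 := by rw [hδdef]; field_simp; ring
        _ ≤ _ := this
        _ = _ := by ring
    calc _ ≤ (1 - k * δ) ^ n * (1 + k * δ) ^ n *
          (ν.real (Set.Ici a) * ν.real (Set.Ici (b + d))) := by gcongr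
      _ = ((1 - k * δ) ^ n * ν.real (Set.Ici a)) *
          ((1 + k * δ) ^ n * ν.real (Set.Ici (b + d))) := by ring
      _ ≤ _ := by gcongr
  have hlim : Filter.Tendsto (fun n : ℕ => (1 - (k * d) ^ 2 / n) *
      (ν.real (Set.Ici a) * ν.real (Set.Ici (b + d)))) Filter.atTop
      (nhds (ν.real (Set.Ici a) * ν.real (Set.Ici (b + d)))) := by
    simpa using ((tendsto_const_div_atTop_nhds_zero_nat ((k * d) ^ 2)).const_sub 1).mul_const
      (ν.real (Set.Ici a) * ν.real (Set.Ici (b + d)))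
  refine le_of_tendsto hlim ?_
  filter_upwards [Filter.eventually_ge_atTop ⌈max (k * d) 1⌉₊] with n h
  exact hn n (Nat.ceil_le.1 h)

/-- A distribution with monotone hazard rate has a log-concave survival function. -/
theorem survival_mul_le {ν : Measure ℝ} [IsProbabilityMeasure ν] {f : ℝ → ℝ}
    (hν : ν = volume.withDensity fun t => ENNReal.ofReal (f t))
    (hmono : MonotoneOn (fun t => f t / ν.real (Set.Ici t)) {t | 0 < ν.real (Set.Ici t)})
    {a b d : ℝ} (hd : 0 ≤ d) (hab : a ≤ b) :
    ν.real (Set.Ici a) * ν.real (Set.Ici (b + d)) ≤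
      ν.real (Set.Ici (a + d)) * ν.real (Set.Ici b) := by
  rcases le_total (a + d) b with h | h
  · exact survival_mul_le_of_add_le hν hmono hd h
  · have := survival_mul_le_of_add_le hν hmono (a := a) (b := a + d) (d := b - a) (by linarith)
      (by linarith)
    rw [show a + d + (b - a) = b + d by ring, show a + (b - a) = b by ring] at this
    linarith

/-- Reweighting by the density with the larger monotone likelihood ratio raises the mean of `M`. -/
theorem integral_mul_le_of_likelihoodRatio {Ω : Type*} [MeasurableSpace Ω] {Q : Measure Ω}
    [IsProbabilityMeasure Q] {M : Ω → ℝ} (hM : Measurable M) {C : ℝ} (hMC : ∀ ω, |M ω| ≤ C) {G₁ G₂ : ℝ → ℝ}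
    (hG₁ : Measurable G₁) (hG₂ : Measurable G₂) {K : ℝ} (hK₁ : ∀ t, |G₁ t| ≤ K)
    (hK₂ : ∀ t, |G₂ t| ≤ K)
    (hG : ∀ u v, v ≤ u → G₂ u * G₁ v ≤ G₁ u * G₂ v) :
    (∫ ω, M ω * G₂ (M ω) ∂Q) * ∫ ω, G₁ (M ω) ∂Q ≤
      (∫ ω, M ω * G₁ (M ω) ∂Q) * ∫ ω, G₂ (M ω) ∂Q := by
  have i1 : Integrable (fun ω => G₁ (M ω)) Q :=
    .of_bound (hG₁.comp hM).aestronglyMeasurable K (.of_forall fun ω => hK₁ _)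
  have i2 : Integrable (fun ω => G₂ (M ω)) Q :=
    .of_bound (hG₂.comp hM).aestronglyMeasurable K (.of_forall fun ω => hK₂ _)
  have j1 : Integrable (fun ω => M ω * G₁ (M ω)) Q :=
    i1.bdd_mul hM.aestronglyMeasurable (.of_forall hMC)
  have j2 : Integrable (fun ω => M ω * G₂ (M ω)) Q :=
    i2.bdd_mul hM.aestronglyMeasurable (.of_forall hMC)
  have key : 0 ≤ ∫ z, (M z.1 * G₁ (M z.1) * G₂ (M z.2) - M z.1 * G₂ (M z.1) * G₁ (M z.2))
      + (G₂ (M z.1) * (M z.2 * G₁ (M z.2)) - G₁ (M z.1) * (M z.2 * G₂ (M z.2))) ∂Q.prod Q := by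
    refine integral_nonneg fun z => ?_
    have : 0 ≤ (M z.1 - M z.2) * (G₁ (M z.1) * G₂ (M z.2) - G₂ (M z.1) * G₁ (M z.2)) := by
      rcases le_total (M z.2) (M z.1) with h | h
      · exact mul_nonneg (by linarith) (by linarith [hG _ _ h])
      · exact mul_nonneg_of_nonpos_of_nonpos (by linarith) (by linarith [hG _ _ h])
    simp only [Pi.zero_apply]
    linarith
  have hsplit := integral_add ((j1.mul_prod i2).sub (j2.mul_prod i1))
    ((i2.mul_prod j1).sub (i1.mul_prod j2))
  have hsub := integral_sub (j1.mul_prod i2) (j2.mul_prod i1)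
  have hsub' := integral_sub (i2.mul_prod j1) (i1.mul_prod j2)
  simp only [Pi.sub_apply] at hsplit
  rw [hsplit, hsub, hsub'] at key
  rw [integral_prod_mul (μ := Q) (ν := Q) (fun ω => M ω * G₁ (M ω)) (fun ω => G₂ (M ω)),
    integral_prod_mul (μ := Q) (ν := Q) (fun ω => M ω * G₂ (M ω)) (fun ω => G₁ (M ω)),
    integral_prod_mul (μ := Q) (ν := Q) (fun ω => G₂ (M ω)) (fun ω => M ω * G₁ (M ω)),
    integral_prod_mul (μ := Q) (ν := Q) (fun ω => G₁ (M ω)) (fun ω => M ω * G₂ (M ω))] at key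
  linarith

/-- Integrating out an independent threshold variable replaces the event by its survival probability. -/
theorem setIntegral_threshold_of_indepFun {Ω β : Type*} [MeasurableSpace Ω] [MeasurableSpace β]
    {Q : Measure Ω} [IsProbabilityMeasure Q] {ε : Ω → ℝ} {V : Ω → β} (hε : Measurable ε)
    (hV : Measurable V) (hind : IndepFun ε V Q) {φ θ : β → ℝ} (hφ : Measurable φ)
    (hθ : Measurable θ) (hint : Integrable (fun ω => φ (V ω)) Q) :
    ∫ ω in {ω | θ (V ω) ≤ ε ω}, φ (V ω) ∂Q =
      ∫ ω, φ (V ω) * (Q.map ε).real (Set.Ici (θ (V ω))) ∂Q := by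
  have hprob : IsProbabilityMeasure (Q.map ε) := Measure.isProbabilityMeasure_map hε.aemeasurable
  have hprob' : IsProbabilityMeasure (Q.map V) := Measure.isProbabilityMeasure_map hV.aemeasurable
  have hmap : Q.map (fun ω => (V ω, ε ω)) = (Q.map V).prod (Q.map ε) :=
    (indepFun_iff_map_prod_eq_prod_map_map hV.aemeasurable hε.aemeasurable).1 hind.symm
  have hS : MeasurableSet {z : β × ℝ | θ z.1 ≤ z.2} :=
    measurableSet_le (hθ.comp measurable_fst) measurable_snd
  have hφ1 : Measurable fun z : β × ℝ => φ z.1 := hφ.comp measurable_fst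
  have hφint : Integrable φ (Q.map V) :=
    (integrable_map_measure hφ.aestronglyMeasurable hV.aemeasurable).2 hint
  have hGm : Measurable fun t => (Q.map ε).real (Set.Ici t) :=
    (show Antitone fun t => (Q.map ε).real (Set.Ici t) from fun s t h =>
      measureReal_mono (Set.Ici_subset_Ici.2 h)).measurable
  calc _ = ∫ ω, {z : β × ℝ | θ z.1 ≤ z.2}.indicator (fun z => φ z.1) (V ω, ε ω) ∂Q := by
        exact (integral_indicator (measurableSet_le (hθ.comp hV) hε)).symm
    _ = ∫ z, {z : β × ℝ | θ z.1 ≤ z.2}.indicator (fun z => φ z.1) z ∂(Q.map V).prod (Q.map ε) := by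
        rw [← hmap, integral_map (hV.prodMk hε).aemeasurable
          (hφ1.indicator hS).aestronglyMeasurable]
    _ = ∫ v, ∫ t, {z : β × ℝ | θ z.1 ≤ z.2}.indicator (fun z => φ z.1) (v, t) ∂(Q.map ε)
          ∂(Q.map V) :=
        integral_prod _ ((hφint.comp_fst _).indicator hS)
    _ = ∫ v, φ v * (Q.map ε).real (Set.Ici (θ v)) ∂(Q.map V) := by
        congr with v
        rw [show (fun t => {z : β × ℝ | θ z.1 ≤ z.2}.indicator (fun z => φ z.1) (v, t)) =
          (Set.Ici (θ v)).indicator fun _ => φ v from rfl, integral_indicator measurableSet_Ici,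
          setIntegral_const, smul_eq_mul, mul_comm]
    _ = _ := integral_map hV.aemeasurable (hφ.mul (hGm.comp hθ)).aestronglyMeasurable

/-- A variable may be replaced by its means over the fibres of a countable-valued `U`. -/
theorem integral_mul_eq_of_fiber_mean {Ω 𝒰 : Type*} [MeasurableSpace Ω] [Countable 𝒰]
    [MeasurableSpace 𝒰] [MeasurableSingletonClass 𝒰] {Q : Measure Ω}
    {U : Ω → 𝒰} (hU : Measurable U) {Y : Ω → ℝ} {m h : 𝒰 → ℝ}
    (hint : Integrable (fun ω => Y ω * h (U ω)) Q)
    (hint' : Integrable (fun ω => m (U ω) * h (U ω)) Q)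
    (hm : ∀ u, ∫ ω in {ω | U ω = u}, Y ω ∂Q = m u * Q.real {ω | U ω = u}) :
    ∫ ω, Y ω * h (U ω) ∂Q = ∫ ω, m (U ω) * h (U ω) ∂Q := by
  have hfib : ∀ u, MeasurableSet {ω | U ω = u} := fun u => hU (measurableSet_singleton u)
  have huniv : (⋃ u, {ω | U ω = u}) = Set.univ := by ext; simp
  have hdisj : Pairwise (Function.onFun Disjoint fun u => {ω | U ω = u}) := fun u v huv =>
    Set.disjoint_left.2 fun ω (h1 : U ω = u) (h2 : U ω = v) => huv (h1.symm.trans h2)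
  rw [← setIntegral_univ, ← huniv, integral_iUnion hfib hdisj hint.integrableOn,
    ← setIntegral_univ (μ := Q), ← huniv, integral_iUnion hfib hdisj hint'.integrableOn]
  congr with u
  have hl : ∫ ω in {ω | U ω = u}, Y ω * h (U ω) ∂Q = ∫ ω in {ω | U ω = u}, Y ω * h u ∂Q :=
    setIntegral_congr_fun (hfib u) fun ω (hω : U ω = u) => by simp only [hω]
  have hr : ∫ ω in {ω | U ω = u}, m (U ω) * h (U ω) ∂Q = ∫ _ in {ω | U ω = u}, m u * h u ∂Q :=
    setIntegral_congr_fun (hfib u) fun ω (hω : U ω = u) => by simp only [hω]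
  rw [hl, hr, integral_mul_const, hm, setIntegral_const, smul_eq_mul]
  ring

/-- **Proposition 1 (bias reversal is robust to noisy decision-making).** If the
police search according to `S^noise_τ := 1(μ(X, R, U) + ε ≥ c − τ·R)` where,
conditionally on `(X, R)`, the prediction error `ε` is independent of `(Y, U)` and
has a density whose hazard rate is strictly increasing, then
`E[Y | X = x, R = 1, S^noise_τ = 1]` is weakly decreasing in `τ`. -/
theorem bias_reversal_noisy
    {Ω : Type*} [MeasurableSpace Ω] (P : Measure Ω) [IsProbabilityMeasure P]
    {𝒳 𝒰 : Type*} [Countable 𝒳] [Countable 𝒰]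
    [MeasurableSpace 𝒳] [MeasurableSingletonClass 𝒳]
    [MeasurableSpace 𝒰] [MeasurableSingletonClass 𝒰]
    (X : Ω → 𝒳) (U : Ω → 𝒰) (R Y : Ω → ℝ) (ε : Ω → ℝ)
    (hX : Measurable X) (hU : Measurable U) (hR : Measurable R) (hY : Measurable Y)
    (hε : Measurable ε)
    (hR01 : ∀ ω, R ω = 0 ∨ R ω = 1) (hY01 : ∀ ω, Y ω = 0 ∨ Y ω = 1)
    -- every point of the essential range of (X, R, U) has positive mass
    (hXRU : ∀ ω, 0 < P {ω' | X ω' = X ω ∧ R ω' = R ω ∧ U ω' = U ω})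
    (c : ℝ) (hc : 0 < c)
    -- μ(x, r, u) = E[Y | X = x, R = r, U = u]
    (μ : 𝒳 → ℝ → 𝒰 → ℝ)
    (hμ : ∀ x r u, μ x r u = condE P Y {ω | X ω = x ∧ R ω = r ∧ U ω = u})
    -- density and CDF of ε conditionally on (X, R)
    (f : 𝒳 → ℝ → ℝ → ℝ) (F : 𝒳 → ℝ → ℝ → ℝ)
    (hfmeas : ∀ x r, Measurable (f x r))
    -- conditionally on each (x, r) in the essential range of (X, R):
    (hcond : ∀ x r, 0 < P {ω | X ω = x ∧ R ω = r} →
      -- ε is independent of the pair (Y, U)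
      (IndepFun ε (fun ω => (Y ω, U ω)) (P[|{ω | X ω = x ∧ R ω = r}])) ∧
      -- ε has density f x r with respect to Lebesgue measure
      (P[|{ω | X ω = x ∧ R ω = r}]).map ε =
        volume.withDensity (fun t => ENNReal.ofReal (f x r t)) ∧
      -- with CDF F x r
      (∀ t : ℝ, F x r t = ((P[|{ω | X ω = x ∧ R ω = r}]) {ω | ε ω ≤ t}).toReal) ∧
      -- whose hazard rate is strictly increasing where F < 1
      StrictMonoOn (fun t => f x r t / (1 - F x r t)) {t | F x r t < 1})
    -- the noisy search indicator S^noise_τ = 1(μ(X, R, U) + ε ≥ c − τ·R)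
    (Sn : ℝ → Ω → ℝ)
    (hSn : ∀ τ ω, Sn τ ω = if c - τ * R ω ≤ μ (X ω) (R ω) (U ω) + ε ω then 1 else 0)
    (x : 𝒳) (τ₁ τ₂ : ℝ) (hτ : τ₁ ≤ τ₂)
    (hpos : 0 < P {ω | X ω = x ∧ R ω = 1 ∧ Sn τ₁ ω = 1}) :
    0 < P {ω | X ω = x ∧ R ω = 1 ∧ Sn τ₂ ω = 1} ∧
      condE P Y {ω | X ω = x ∧ R ω = 1 ∧ Sn τ₂ ω = 1} ≤
        condE P Y {ω | X ω = x ∧ R ω = 1 ∧ Sn τ₁ ω = 1} := by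
  set A : Set Ω := {ω | X ω = x ∧ R ω = 1} with hAdef
  set Q : Measure Ω := P[|A] with hQdef
  set m : 𝒰 → ℝ := μ x 1 with hmdef
  have hA : MeasurableSet A :=
    (hX (measurableSet_singleton x)).inter (hR (measurableSet_singleton 1))
  have hE : ∀ τ, {ω | X ω = x ∧ R ω = 1 ∧ Sn τ ω = 1} =
      A ∩ {ω | c - τ - m (U ω) ≤ ε ω} := fun τ => by
    ext ω
    simp only [hAdef, hmdef, Set.mem_ofPred_eq, Set.mem_inter_iff, and_assoc]
    refine and_congr_right fun hx => and_congr_right fun hr => ?_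
    rw [hSn, hx, hr, mul_one, ite_eq_left_iff]
    simp only [zero_ne_one, imp_false, not_not]
    exact sub_le_iff_le_add'.symm
  have hB : ∀ τ, MeasurableSet {ω | c - τ - m (U ω) ≤ ε ω} := fun τ =>
    measurableSet_le (((measurable_of_countable m).comp hU).const_sub _) hε
  have hPA : 0 < P A := hpos.trans_le (measure_mono fun ω hω => ⟨hω.1, hω.2.1⟩)
  have hpos₂ : 0 < P {ω | X ω = x ∧ R ω = 1 ∧ Sn τ₂ ω = 1} := by
    refine hpos.trans_le (measure_mono ?_)
    rw [hE, hE]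
    refine Set.inter_subset_inter_right _ fun ω hω => ?_
    rw [Set.mem_ofPred_eq] at hω ⊢
    linarith
  refine ⟨hpos₂, ?_⟩
  have hQ : IsProbabilityMeasure Q := cond_isProbabilityMeasure hPA.ne'
  obtain ⟨hind, hdens, hF, hhaz⟩ := hcond x 1 hPA
  have hQpos : ∀ τ, 0 < P {ω | X ω = x ∧ R ω = 1 ∧ Sn τ ω = 1} →
      0 < Q.real {ω | c - τ - m (U ω) ≤ ε ω} := fun τ h => by
    rw [hE] at h
    refine ENNReal.toReal_pos ?_ (measure_ne_top _ _)
    rw [hQdef, cond_apply hA]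
    exact mul_ne_zero (ENNReal.inv_ne_zero.2 (measure_ne_top _ _)) h.ne'
  have hYabs : ∀ ω, |Y ω| ≤ 1 := fun ω => by rcases hY01 ω with h | h <;> simp [h]
  have hmabs : ∀ u, |m u| ≤ 1 := fun u => by
    rw [hmdef, hμ]; exact abs_condE_le_one hYabs _
  have hfib : ∀ u, ∫ ω in {ω | U ω = u}, Y ω ∂Q = m u * Q.real {ω | U ω = u} := fun u => by
    have hmu : m u = condE Q Y {ω | U ω = u} := by
      rw [hmdef, hμ, ← condE_inter Y hA
        (show MeasurableSet {ω | U ω = u} from hU (measurableSet_singleton u)) hPA.ne']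
      congr 1
      ext ω
      exact and_assoc.symm
    rw [hmu, condE]
    by_cases h0 : Q {ω | U ω = u} = 0
    · rw [setIntegral_measure_zero _ h0, zero_div, zero_mul]
    · exact (div_mul_cancel₀ _ (ENNReal.toReal_ne_zero.2 ⟨h0, measure_ne_top _ _⟩)).symm
  set ν : Measure ℝ := Q.map ε with hνdef
  have hν : IsProbabilityMeasure ν := Measure.isProbabilityMeasure_map hε.aemeasurable
  have hatoms : NullSingletonClass ν := ⟨fun t => by
    rw [hdens]; exact withDensity_absolutelyContinuous _ _ Real.volume_singleton⟩
  have hsurv : ∀ t, 1 - F x 1 t = ν.real (Set.Ici t) := fun t => by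
    rw [hF, ← measureReal_congr (Ioi_ae_eq_Ici (μ := ν)), ← Set.compl_Iic,
      probReal_compl_eq_one_sub measurableSet_Iic, hνdef,
      map_measureReal_apply hε measurableSet_Iic]
    rfl
  have hmono : MonotoneOn (fun t => f x 1 t / ν.real (Set.Ici t))
      {t | 0 < ν.real (Set.Ici t)} := by
    simp only [hsurv] at hhaz
    refine hhaz.monotoneOn.mono fun t ht => ?_
    rw [Set.mem_ofPred_eq, ← hsurv] at ht
    exact sub_pos.1 ht
  have hGanti : Antitone fun t => ν.real (Set.Ici t) := fun s t h =>
    measureReal_mono (Set.Ici_subset_Ici.2 h)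
  have hGabs : ∀ t, |ν.real (Set.Ici t)| ≤ 1 := fun t => by
    rw [abs_of_nonneg measureReal_nonneg]; exact measureReal_le_one
  have hGm : ∀ s, Measurable fun u => ν.real (Set.Ici (s - u)) := fun s =>
    hGanti.measurable.comp (measurable_id.const_sub s)
  have hMm : Measurable fun ω => m (U ω) := (measurable_of_countable m).comp hU
  have hYint : Integrable Y Q := .of_bound hY.aestronglyMeasurable 1 (.of_forall hYabs)
  have hMint : Integrable (fun ω => m (U ω)) Q :=
    .of_bound hMm.aestronglyMeasurable 1 (.of_forall fun ω => hmabs _)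
  have hGU : ∀ s, AEStronglyMeasurable (fun ω => ν.real (Set.Ici (s - m (U ω)))) Q := fun s =>
    ((hGm s).comp hMm).aestronglyMeasurable
  have hθ : ∀ s, Measurable fun v : ℝ × 𝒰 => s - m v.2 := fun s =>
    ((measurable_of_countable m).comp measurable_snd).const_sub s
  have hnum : ∀ τ, ∫ ω in {ω | c - τ - m (U ω) ≤ ε ω}, Y ω ∂Q =
      ∫ ω, m (U ω) * ν.real (Set.Ici (c - τ - m (U ω))) ∂Q := fun τ => by
    rw [← integral_mul_eq_of_fiber_mean hU (Y := Y)
      (h := fun u => ν.real (Set.Ici (c - τ - m u)))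
      (hYint.mul_bdd (hGU _) (.of_forall fun ω => hGabs _))
      (hMint.mul_bdd (hGU _) (.of_forall fun ω => hGabs _)) hfib]
    exact setIntegral_threshold_of_indepFun hε (hY.prodMk hU) hind measurable_fst (hθ (c - τ)) hYint
  have hden : ∀ τ, Q.real {ω | c - τ - m (U ω) ≤ ε ω} =
      ∫ ω, ν.real (Set.Ici (c - τ - m (U ω))) ∂Q := fun τ => by
    simpa using setIntegral_threshold_of_indepFun hε (hY.prodMk hU) hind
      (φ := fun _ => 1) measurable_const (hθ (c - τ)) (integrable_const 1)
  rw [hE, hE, condE_inter Y hA (hB _) hPA.ne', condE_inter Y hA (hB _) hPA.ne', condE, condE]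
  refine (div_le_div_iff₀ (hQpos _ hpos₂) (hQpos _ hpos)).2 ?_
  change _ * Q.real _ ≤ _ * Q.real _
  rw [hnum, hnum, hden, hden]
  refine integral_mul_le_of_likelihoodRatio hMm (fun ω => hmabs _)
    (G₁ := fun u => ν.real (Set.Ici (c - τ₁ - u))) (G₂ := fun u => ν.real (Set.Ici (c - τ₂ - u)))
    (hGm _) (hGm _) (fun _ => hGabs _) (fun _ => hGabs _) fun u v huv => ?_
  have h := survival_mul_le hdens hmono (a := c - τ₂ - u) (b := c - τ₂ - v) (d := τ₂ - τ₁)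
    (by linarith) (by linarith)
  rwa [show c - τ₂ - v + (τ₂ - τ₁) = c - τ₁ - v by ring,
    show c - τ₂ - u + (τ₂ - τ₁) = c - τ₁ - u by ring] at h
end

section
/- Suppose the police search according to S^noise_τ := 1(μ(X, R, U) + ε ≥ c − τ·R), where ε is a real-valued random variable such that, for each (x, r) in the essential range of (X, R), under the conditional measure ℙ(· | X = x, R = r) the variable ε is independent of the pair (Y, U). Then for every x ∈ 𝒳 with ℙ(X = x, R = 1) > 0 and every τ₁ ≤ τ₂, E[Y·S^noise_{τ₁} | X = x, R = 1] ≤ E[Y·S^noise_{τ₂} | X = x, R = 1] (Proposition 2, part for the compound label Y·S^noise). -/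
open MeasureTheory ProbabilityTheory

/-- **Proposition 2, part for the compound label `Y·S^noise`.** If the police search according to
`S^noise_τ := 1(μ(X, R, U) + ε ≥ c − τ·R)` where, conditionally on `(X, R)`, the
prediction error `ε` is independent of `(Y, U)`,  then `E[Y·S^noise_τ | X = x, R = 1]`
is weakly increasing in `τ`. -/
theorem bias_inheritance_YSnoise
    {Ω : Type*} [MeasurableSpace Ω] (P : Measure Ω) [IsProbabilityMeasure P]
    {𝒳 𝒰 : Type*} [Countable 𝒳] [Countable 𝒰]
    [MeasurableSpace 𝒳] [MeasurableSingletonClass 𝒳]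
    [MeasurableSpace 𝒰] [MeasurableSingletonClass 𝒰]
    (X : Ω → 𝒳) (U : Ω → 𝒰) (R Y : Ω → ℝ) (ε : Ω → ℝ)
    (hX : Measurable X) (hU : Measurable U) (hR : Measurable R) (hY : Measurable Y)
    (hε : Measurable ε)
    (hR01 : ∀ ω, R ω = 0 ∨ R ω = 1) (hY01 : ∀ ω, Y ω = 0 ∨ Y ω = 1)
    -- every point of the essential range of (X, R, U) has positive mass
    (hXRU : ∀ ω, 0 < P {ω' | X ω' = X ω ∧ R ω' = R ω ∧ U ω' = U ω})
    (c : ℝ) (hc : 0 < c)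
    -- μ(x, r, u) = E[Y | X = x, R = r, U = u]
    (μ : 𝒳 → ℝ → 𝒰 → ℝ)
    (hμ : ∀ x r u, μ x r u = condE P Y {ω | X ω = x ∧ R ω = r ∧ U ω = u})
    -- conditionally on each (x, r) in the essential range of (X, R),
    -- ε is independent of the pair (Y, U)
    (hcond : ∀ x r, 0 < P {ω | X ω = x ∧ R ω = r} →
      IndepFun ε (fun ω => (Y ω, U ω)) (P[|{ω | X ω = x ∧ R ω = r}]))
    -- the noisy search indicator S^noise_τ = 1(μ(X, R, U) + ε ≥ c − τ·R)
    (Sn : ℝ → Ω → ℝ)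
    (hSn : ∀ τ ω, Sn τ ω = if c - τ * R ω ≤ μ (X ω) (R ω) (U ω) + ε ω then 1 else 0)
    (x : 𝒳) (hx : 0 < P {ω | X ω = x ∧ R ω = 1})
    (τ₁ τ₂ : ℝ) (hτ : τ₁ ≤ τ₂) :
    condE P (fun ω => Y ω * Sn τ₁ ω) {ω | X ω = x ∧ R ω = 1} ≤
      condE P (fun ω => Y ω * Sn τ₂ ω) {ω | X ω = x ∧ R ω = 1} := by
  have hA : MeasurableSet {ω | X ω = x ∧ R ω = 1} :=
    (hX (measurableSet_singleton x)).inter (hR (measurableSet_singleton 1))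
  have hμm : Measurable fun ω => μ x 1 (U ω) + ε ω :=
    ((measurable_of_countable (μ x 1)).comp hU).add hε
  -- On the conditioning event the label agrees with a function that is measurable everywhere.
  have hcongr : ∀ τ, ∫ ω in {ω | X ω = x ∧ R ω = 1}, Y ω * Sn τ ω ∂P =
      ∫ ω in {ω | X ω = x ∧ R ω = 1},
        Y ω * (if c - τ ≤ μ x 1 (U ω) + ε ω then 1 else 0) ∂P := by
    intro τ
    refine setIntegral_congr_fun hA fun ω hω => ?_
    obtain ⟨h₁, h₂⟩ := hω
    simp only [hSn, h₁, h₂, mul_one]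
  have hint : ∀ τ, Integrable
      (fun ω => Y ω * (if c - τ ≤ μ x 1 (U ω) + ε ω then 1 else 0)) P := by
    intro τ
    refine Integrable.of_bound (C := 1) (hY.mul (Measurable.ite
      (measurableSet_le measurable_const hμm) measurable_const
      measurable_const)).aestronglyMeasurable (Filter.Eventually.of_forall fun ω => ?_)
    rcases hY01 ω with h | h <;> split_ifs <;> simp [h]
  unfold condE
  rw [hcongr, hcongr]
  refine div_le_div_of_nonneg_right ?_ ENNReal.toReal_nonneg
  refine setIntegral_mono (hint τ₁).integrableOn (hint τ₂).integrableOn fun ω => ?_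
  have hY0 : 0 ≤ Y ω := by rcases hY01 ω with h | h <;> simp [h]
  refine mul_le_mul_of_nonneg_left ?_ hY0
  split_ifs <;> linarith
end

section
/- Suppose the police search according to S^noise_τ := 1(μ(X, R, U) + ε ≥ c − τ·R), where ε is a real-valued random variable such that, for each (x, r) in the essential range of (X, R), under ℙ(· | X = x, R = r) the variable ε is independent of U and has a density f_{x,r} with CDF F_{x,r} whose hazard rate t ↦ f_{x,r}(t)/(1 − F_{x,r}(t)) is nondecreasing on {t : F_{x,r}(t) < 1}. Fix x ∈ 𝒳 with ℙ(X = x, R = 1) > 0 and real values μ₁ < μ₂ with ℙ(μ(X, R, U) = μᵢ, X = x, R = 1) > 0 for i = 1, 2. Then the conditional distribution of μ(X, R, U) given {S^noise_τ = 1, X = x, R = 1} is ordered in the monotone likelihood ratio sense across τ: for any τ₁ ≤ τ₂ with ℙ(S^noise_{τ₁} = 1, X = x, R = 1) > 0, ℙ(μ(X,R,U) = μ₁ | S^noise_{τ₁} = 1, X = x, R = 1) · ℙ(μ(X,R,U) = μ₂ | S^noise_{τ₂} = 1, X = x, R = 1) ≤ ℙ(μ(X,R,U) = μ₁ | S^noise_{τ₂}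 = 1, X = x, R = 1) · ℙ(μ(X,R,U) = μ₂ | S^noise_{τ₁} = 1, X = x, R = 1); that is, the likelihood ratio of the lower value μ₁ to the higher value μ₂ is weakly increasing in τ (Appendix Lemma 1). -/
open MeasureTheory ProbabilityTheory

/-- Conditional probability of an event given an event: `P(B | A) = P(B ∩ A) / P(A)`. -/
noncomputable def condP {Ω : Type*} [MeasurableSpace Ω] (P : Measure Ω)
    (B A : Set Ω) : ℝ :=
  (P (B ∩ A)).toReal / (P A).toReal

section

open Set Filter Topology

/-- A function whose increments satisfy `G s - G t ≥ k (t - s) G t` decays at least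
exponentially, with rate `k`. -/
lemma mul_exp_le_of_increment {G : ℝ → ℝ} {a b k : ℝ} (hab : a ≤ b)
    (h : ∀ s t, a ≤ s → s ≤ t → t ≤ b → k * (t - s) * G t ≤ G s - G t) :
    G b * Real.exp (k * (b - a)) ≤ G a := by
  have hlim := (Real.tendsto_one_add_div_pow_exp (k * (b - a))).const_mul (G b)
  refine le_of_tendsto hlim ?_
  have hev : ∀ᶠ n : ℕ in atTop, -1 < k * (b - a) / (n : ℝ) :=
    (tendsto_const_div_atTop_nhds_zero_nat (k * (b - a))).eventually (lt_mem_nhds (by norm_num))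
  filter_upwards [hev, eventually_gt_atTop 0] with n hn hn0
  have hn0' : (0 : ℝ) < n := by exact_mod_cast hn0
  set q : ℝ := 1 + k * (b - a) / n with hq
  have hq0 : 0 ≤ q := by linarith
  have key : ∀ m : ℕ, m ≤ n → G (a + m * ((b - a) / n)) * q ^ m ≤ G a := by
    intro m
    induction m with
    | zero => simp
    | succ m ih =>
      intro hm
      have hδ : 0 ≤ (b - a) / n := div_nonneg (by linarith) hn0'.le
      have hm' : ((m + 1 : ℕ) : ℝ) ≤ n := by exact_mod_cast hm
      have hend : a + ((m + 1 : ℕ) : ℝ) * ((b - a) / n) ≤ b := by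
        have := mul_le_mul_of_nonneg_right hm' hδ
        rw [mul_div_cancel₀ _ hn0'.ne'] at this
        linarith
      have hstep := h (a + m * ((b - a) / n)) (a + ((m + 1 : ℕ) : ℝ) * ((b - a) / n))
        (by have : 0 ≤ (m : ℝ) * ((b - a) / n) := by positivity
            linarith) (by push_cast; linarith) hend
      have hstep' : G (a + ((m + 1 : ℕ) : ℝ) * ((b - a) / n)) * q ≤ G (a + m * ((b - a) / n)) := by
        have e : k * (a + ((m + 1 : ℕ) : ℝ) * ((b - a) / n) - (a + m * ((b - a) / n)))
            = q - 1 := by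
          rw [hq]; push_cast; ring
        rw [e] at hstep
        linarith
      calc _ = (G (a + ((m + 1 : ℕ) : ℝ) * ((b - a) / n)) * q) * q ^ m := by ring
        _ ≤ G (a + m * ((b - a) / n)) * q ^ m := by gcongr
        _ ≤ G a := ih (by omega)
  have := key n le_rfl
  rwa [mul_div_cancel₀ _ hn0'.ne', add_sub_cancel] at this

/-- A function whose increments satisfy `G s - G t ≤ k (t - s) G s` decays at most
exponentially, with rate `k`. -/
lemma le_mul_exp_of_increment {G : ℝ → ℝ} {a b k : ℝ} (hab : a ≤ b)
    (h : ∀ s t, a ≤ s → s ≤ t → t ≤ b → G s - G t ≤ k * (t - s) * G s) :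
    G a ≤ G b * Real.exp (k * (b - a)) := by
  have := mul_exp_le_of_increment (G := fun t => G (-t)) (a := -b) (b := -a)
    (k := -k) (by linarith) (fun s t hs hst ht => by
      have := h (-t) (-s) (by linarith) (by linarith) (by linarith)
      linarith)
  simp only [neg_neg] at this
  calc G a = G a * Real.exp (-k * (-a - -b)) * Real.exp (k * (b - a)) := by
        rw [mul_assoc, ← Real.exp_add]
        ring_nf
        simp
    _ ≤ _ := by gcongr

/-- A probability measure on `ℝ` whose density has nondecreasing hazard rate has a
log-concave survival function. -/
lemma survival_mul_le_of_monotone_hazard (ν : Measure ℝ) [IsProbabilityMeasure ν] {f : ℝ → ℝ}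
    (hν : ν = volume.withDensity (fun t => ENNReal.ofReal (f t)))
    (hmono : MonotoneOn (fun t => f t / ν.real (Ici t)) {t | 0 < ν.real (Ici t)})
    {a d e : ℝ} (hd : 0 ≤ d) (he : 0 ≤ e) :
    ν.real (Ici (a + d + e)) * ν.real (Ici a) ≤ ν.real (Ici (a + d)) * ν.real (Ici (a + e)) := by
  wlog hde : d ≤ e generalizing d e
  · have := this he hd (by linarith)
    rw [add_right_comm, mul_comm (ν.real (Ici (a + e)))] at this
    exact this
  set G : ℝ → ℝ := fun t => ν.real (Ici t) with hGdef
  have hG0 : ∀ t, 0 ≤ G t := fun t => measureReal_nonneg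
  have hanti : Antitone G := fun s t hst => measureReal_mono (Ici_subset_Ici.2 hst)
  change G (a + d + e) * G a ≤ G (a + d) * G (a + e)
  rcases (hG0 (a + d + e)).eq_or_lt with h0 | hpos
  · rw [← h0, zero_mul]
    exact mul_nonneg (hG0 _) (hG0 _)
  have hposle : ∀ t, t ≤ a + d + e → 0 < G t := fun t ht => hpos.trans_le (hanti ht)
  set k : ℝ → ℝ := fun t => max (f t / G t) 0 with hk
  have hk0 : ∀ t, 0 ≤ k t := fun t => le_max_right _ _
  have hkmono : ∀ s t, s ≤ t → t ≤ a + d + e → k s ≤ k t := fun s t hst ht =>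
    max_le_max (hmono (hposle s (hst.trans ht)) (hposle t ht) hst) le_rfl
  have hfk : ∀ t, t ≤ a + d + e → ENNReal.ofReal (f t) = ENNReal.ofReal (k t * G t) := by
    intro t ht
    have := hposle t ht
    rw [hk]
    dsimp only
    rw [max_mul_of_nonneg _ _ this.le, div_mul_cancel₀ _ this.ne', zero_mul]
    simp [ENNReal.ofReal_max]
  have hincr : ∀ s t, s ≤ t → G s - G t = (∫⁻ u in Ico s t, ENNReal.ofReal (f u)).toReal := by
    intro s t hst
    have : ν.real (Ico s t) = (∫⁻ u in Ico s t, ENNReal.ofReal (f u)).toReal := by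
      rw [measureReal_def, hν, withDensity_apply _ measurableSet_Ico]
    rw [← this, ← Ici_sdiff_Ici, measureReal_sdiff (Ici_subset_Ici.2 hst) measurableSet_Ici]
  have hconst : ∀ s t C : ℝ, s ≤ t → 0 ≤ C →
      (∫⁻ _ in Ico s t, ENNReal.ofReal C) = ENNReal.ofReal (C * (t - s)) := by
    intro s t C hst hC
    rw [setLIntegral_const, Real.volume_Ico, ENNReal.ofReal_mul hC]
  have hupper : ∀ s t, s ≤ t → t ≤ a + d + e → G s - G t ≤ k t * (t - s) * G s := by
    intro s t hst ht
    rw [hincr s t hst]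
    refine ENNReal.toReal_le_of_le_ofReal
      (mul_nonneg (mul_nonneg (hk0 _) (by linarith)) (hG0 _)) ?_
    rw [mul_right_comm, ← hconst s t _ hst (mul_nonneg (hk0 _) (hG0 _))]
    refine setLIntegral_mono' measurableSet_Ico fun u hu => ?_
    rw [hfk u (hu.2.le.trans ht)]
    exact ENNReal.ofReal_le_ofReal
      (mul_le_mul (hkmono u t hu.2.le ht) (hanti hu.1) (hG0 _) (hk0 _))
  have hlower : ∀ s t, s ≤ t → t ≤ a + d + e → k s * (t - s) * G t ≤ G s - G t := by
    intro s t hst ht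
    have hfin : (∫⁻ u in Ico s t, ENNReal.ofReal (f u)) ≠ ⊤ := by
      rw [← withDensity_apply _ measurableSet_Ico, ← hν]
      exact measure_ne_top _ _
    rw [hincr s t hst]
    refine (ENNReal.ofReal_le_iff_le_toReal hfin).1 ?_
    rw [mul_right_comm, ← hconst s t _ hst (mul_nonneg (hk0 _) (hG0 _))]
    refine setLIntegral_mono' measurableSet_Ico fun u hu => ?_
    rw [hfk u (hu.2.le.trans ht)]
    exact ENNReal.ofReal_le_ofReal
      (mul_le_mul (hkmono s u hu.1 (hu.2.le.trans ht)) (hanti hu.2.le) (hG0 _) (hk0 _))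
  have hfst : G a ≤ G (a + d) * Real.exp (k (a + d) * (a + d - a)) :=
    le_mul_exp_of_increment (by linarith) fun s t _ hst ht =>
      (hupper s t hst (by linarith)).trans (mul_le_mul_of_nonneg_right
        (mul_le_mul_of_nonneg_right (hkmono t _ ht (by linarith)) (by linarith)) (hG0 _))
  have hsnd : G (a + d + e) * Real.exp (k (a + d) * (a + d + e - (a + e))) ≤ G (a + e) :=
    mul_exp_le_of_increment (by linarith) fun s t hs hst ht =>
      le_trans (mul_le_mul_of_nonneg_right (mul_le_mul_of_nonneg_right
        (hkmono _ s (by linarith) (by linarith)) (by linarith)) (hG0 _)) (hlower s t hst ht)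
  rw [show a + d - a = d by ring] at hfst
  rw [show a + d + e - (a + e) = d by ring] at hsnd
  calc G (a + d + e) * G a
      ≤ G (a + d + e) * (G (a + d) * Real.exp (k (a + d) * d)) :=
        mul_le_mul_of_nonneg_left hfst (hG0 _)
    _ = G (a + d) * (G (a + d + e) * Real.exp (k (a + d) * d)) := by ring
    _ ≤ G (a + d) * G (a + e) := mul_le_mul_of_nonneg_left hsnd (hG0 _)

end

/-- **Appendix Lemma 1 (monotone likelihood ratio).** With the noisy search rule
`S^noise_τ := 1(μ(X, R, U) + ε ≥ c − τ·R)`, where conditionally on `(X, R)` the error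
`ε` is independent of `U` and has a density with nondecreasing hazard rate, the
conditional distribution of `μ(X, R, U)` given `{S^noise_τ = 1, X = x, R = 1}` is
ordered in the monotone likelihood ratio sense across `τ`: the likelihood ratio of a
lower value `μ₁` to a higher value `μ₂` is weakly increasing in `τ`. -/
theorem mlr_lemma_noise
    {Ω : Type*} [MeasurableSpace Ω] (P : Measure Ω) [IsProbabilityMeasure P]
    {𝒳 𝒰 : Type*} [Countable 𝒳] [Countable 𝒰]
    [MeasurableSpace 𝒳] [MeasurableSingletonClass 𝒳]
    [MeasurableSpace 𝒰] [MeasurableSingletonClass 𝒰]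
    (X : Ω → 𝒳) (U : Ω → 𝒰) (R Y : Ω → ℝ) (ε : Ω → ℝ)
    (hX : Measurable X) (hU : Measurable U) (hR : Measurable R) (hY : Measurable Y)
    (hε : Measurable ε)
    (hR01 : ∀ ω, R ω = 0 ∨ R ω = 1) (hY01 : ∀ ω, Y ω = 0 ∨ Y ω = 1)
    -- every point of the essential range of (X, R, U) has positive mass
    (hXRU : ∀ ω, 0 < P {ω' | X ω' = X ω ∧ R ω' = R ω ∧ U ω' = U ω})
    (c : ℝ) (hc : 0 < c)
    -- μ(x, r, u) = E[Y | X = x, R = r, U = u]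
    (μ : 𝒳 → ℝ → 𝒰 → ℝ)
    (hμ : ∀ x r u, μ x r u = condE P Y {ω | X ω = x ∧ R ω = r ∧ U ω = u})
    -- density and CDF of ε conditionally on (X, R)
    (f : 𝒳 → ℝ → ℝ → ℝ) (F : 𝒳 → ℝ → ℝ → ℝ)
    (hfmeas : ∀ x r, Measurable (f x r))
    -- conditionally on each (x, r) in the essential range of (X, R):
    (hcond : ∀ x r, 0 < P {ω | X ω = x ∧ R ω = r} →
      -- ε is independent of U
      (IndepFun ε U (P[|{ω | X ω = x ∧ R ω = r}])) ∧
      -- ε has density f x r with respect to Lebesgue measure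
      (P[|{ω | X ω = x ∧ R ω = r}]).map ε =
        volume.withDensity (fun t => ENNReal.ofReal (f x r t)) ∧
      -- with CDF F x r
      (∀ t : ℝ, F x r t = ((P[|{ω | X ω = x ∧ R ω = r}]) {ω | ε ω ≤ t}).toReal) ∧
      -- whose hazard rate is nondecreasing where F < 1
      MonotoneOn (fun t => f x r t / (1 - F x r t)) {t | F x r t < 1})
    -- the noisy search indicator S^noise_τ = 1(μ(X, R, U) + ε ≥ c − τ·R)
    (Sn : ℝ → Ω → ℝ)
    (hSn : ∀ τ ω, Sn τ ω = if c - τ * R ω ≤ μ (X ω) (R ω) (U ω) + ε ω then 1 else 0)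
    (x : 𝒳) (hx : 0 < P {ω | X ω = x ∧ R ω = 1})
    (μ₁ μ₂ : ℝ) (hμ12 : μ₁ < μ₂)
    (hμ₁pos : 0 < P {ω | μ (X ω) (R ω) (U ω) = μ₁ ∧ X ω = x ∧ R ω = 1})
    (hμ₂pos : 0 < P {ω | μ (X ω) (R ω) (U ω) = μ₂ ∧ X ω = x ∧ R ω = 1})
    (τ₁ τ₂ : ℝ) (hτ : τ₁ ≤ τ₂)
    (hpos : 0 < P ({ω | Sn τ₁ ω = 1} ∩ {ω | X ω = x ∧ R ω = 1})) :
    condP P {ω | μ (X ω) (R ω) (U ω) = μ₁} ({ω | Sn τ₁ ω = 1} ∩ {ω | X ω = x ∧ R ω = 1}) *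
        condP P {ω | μ (X ω) (R ω) (U ω) = μ₂} ({ω | Sn τ₂ ω = 1} ∩ {ω | X ω = x ∧ R ω = 1}) ≤
      condP P {ω | μ (X ω) (R ω) (U ω) = μ₁} ({ω | Sn τ₂ ω = 1} ∩ {ω | X ω = x ∧ R ω = 1}) *
        condP P {ω | μ (X ω) (R ω) (U ω) = μ₂} ({ω | Sn τ₁ ω = 1} ∩ {ω | X ω = x ∧ R ω = 1}) := by
  obtain ⟨hind, hdens, hF, hmono⟩ := hcond x 1 hx
  set A : Set Ω := {ω | X ω = x ∧ R ω = 1} with hA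
  have hAm : MeasurableSet A :=
    (hX (measurableSet_singleton x)).inter (hR (measurableSet_singleton 1))
  set Q : Measure Ω := P[|A] with hQ
  have hQprob : IsProbabilityMeasure Q := cond_isProbabilityMeasure hx.ne'
  set ν : Measure ℝ := Q.map ε with hν
  have hνprob : IsProbabilityMeasure ν := Measure.isProbabilityMeasure_map hε.aemeasurable
  have hsurv : ∀ t, ν.real (Set.Ici t) = 1 - F x 1 t := by
    intro t
    have hcdf : F x 1 t = ν.real (Set.Iic t) := by
      rw [hF, measureReal_def, hν, Measure.map_apply hε measurableSet_Iic]
      rfl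
    have hac : ν ≪ volume := hdens ▸ withDensity_absolutelyContinuous _ _
    have hae : (Set.Ici t : Set ℝ) =ᵐ[ν] Set.Ioi t :=
      (hac.ae_eq Ioi_ae_eq_Ici).symm
    rw [hcdf, measureReal_congr hae, ← Set.compl_Iic, probReal_compl_eq_one_sub measurableSet_Iic]
  have hhaz : MonotoneOn (fun t => f x 1 t / ν.real (Set.Ici t)) {t | 0 < ν.real (Set.Ici t)} := by
    simpa only [hsurv, sub_pos] using hmono
  have hjoint : ∀ m τ : ℝ,
      (P ({ω | μ (X ω) (R ω) (U ω) = m} ∩ ({ω | Sn τ ω = 1} ∩ A))).toReal =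
        P.real A * Q.real (U ⁻¹' {u | μ x 1 u = m}) * ν.real (Set.Ici (c - τ - m)) := by
    intro m τ
    have hset : {ω | μ (X ω) (R ω) (U ω) = m} ∩ ({ω | Sn τ ω = 1} ∩ A) =
        A ∩ (ε ⁻¹' Set.Ici (c - τ - m) ∩ U ⁻¹' {u | μ x 1 u = m}) := by
      ext ω
      simp only [Set.mem_inter_iff, Set.mem_ofPred_eq, Set.mem_preimage, Set.mem_Ici, hA, hSn]
      constructor
      · rintro ⟨h1, h2, h3, h4⟩
        rw [h3, h4] at h1 h2
        refine ⟨⟨h3, h4⟩, ?_, h1⟩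
        rw [h1] at h2
        split_ifs at h2 with h
        · linarith
        · norm_num at h2
      · rintro ⟨⟨h3, h4⟩, h2, h1⟩
        rw [h3, h4, h1]
        exact ⟨rfl, if_pos (by linarith), rfl, rfl⟩
    have hindep := hind.measure_inter_preimage_eq_mul _ _ (measurableSet_Ici (a := c - τ - m))
      (Set.to_countable {u | μ x 1 u = m}).measurableSet
    have hPA : P (A ∩ (ε ⁻¹' Set.Ici (c - τ - m) ∩ U ⁻¹' {u | μ x 1 u = m})) =
        Q (ε ⁻¹' Set.Ici (c - τ - m) ∩ U ⁻¹' {u | μ x 1 u = m}) * P A :=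
      (cond_mul_eq_inter hAm _ _).symm
    rw [hset, hPA, hindep, ENNReal.toReal_mul, ENNReal.toReal_mul, measureReal_def,
      measureReal_def, measureReal_def, hν, Measure.map_apply hε measurableSet_Ici]
    ring
  have hlc := survival_mul_le_of_monotone_hazard ν hdens hhaz (a := c - τ₂ - μ₂)
    (sub_nonneg.2 hτ) (sub_nonneg.2 hμ12.le)
  rw [show c - τ₂ - μ₂ + (τ₂ - τ₁) + (μ₂ - μ₁) = c - τ₁ - μ₁ by ring,
    show c - τ₂ - μ₂ + (τ₂ - τ₁) = c - τ₁ - μ₂ by ring,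
    show c - τ₂ - μ₂ + (μ₂ - μ₁) = c - τ₂ - μ₁ by ring] at hlc
  simp only [condP, hjoint]
  rw [div_mul_div_comm, div_mul_div_comm, mul_comm (P ({ω | Sn τ₂ ω = 1} ∩ A)).toReal]
  refine div_le_div_of_nonneg_right ?_ (by positivity)
  set w₁ := P.real A * Q.real (U ⁻¹' {u | μ x 1 u = μ₁})
  set w₂ := P.real A * Q.real (U ⁻¹' {u | μ x 1 u = μ₂})
  have hw : 0 ≤ w₁ * w₂ := by positivity
  linarith [mul_le_mul_of_nonneg_left hlc hw]
end
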